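/- Let d ≥ 1 and let c be the minimum of Ω(|G|) (the number of prime factors of |G| counted with multiplicity, i.e. the composition length) taken over all finite solvable groups G whose derived length equals d. Then γ·log₂ c − 2/3 < d < (γ+1)·log₂ c + 3, where γ = 5·log₉ 2. -/

import Mathlib

/-- `Omega n` is the number of prime factors of `n` counted with multiplicity,
usually denoted `Ω(n)`.  For a finite solvable group `G`, `Omega (Nat.card G)`
is the composition length of `G`. -/
def Omega (n : ℕ) : ℕ := n.primeFactorsList.length

/-- `DerivedLengthEq G d` says that the derived (solvable) length of `G` is exactly `d`:
the `d`-th term of the derived series is trivial and no earlier term is trivial. -/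
def DerivedLengthEq (G : Type*) [Group G] (d : ℕ) : Prop :=
  derivedSeries G d = ⊥ ∧ ∀ k < d, derivedSeries G k ≠ ⊥

theorem ds_map_le {G : Type*} [Group G] {H : Type*} [Group H] (f : G →* H) (m : ℕ) {g : G}
    (hg : g ∈ derivedSeries G m) : f g ∈ derivedSeries H m :=
  map_derivedSeries_le_derivedSeries f m (Subgroup.mem_map_of_mem f hg)

theorem ds_add_le {G : Type*} [Group G] (S : Subgroup G) (a b : ℕ)
    (h : derivedSeries G a ≤ S) :
    derivedSeries G (a + b) ≤ (derivedSeries S b).map S.subtype := by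
  induction b with
  | zero => simpa [← MonoidHom.range_eq_map] using h
  | succ b ih =>
    rw [← add_assoc, derivedSeries_succ, derivedSeries_succ, Subgroup.map_commutator]
    exact Subgroup.commutator_mono ih ih

theorem ds_add_mem {G : Type*} [Group G] (S : Subgroup G) (a b : ℕ)
    (h : derivedSeries G a ≤ S) {g : G} (hg : g ∈ derivedSeries G (a + b)) :
    ∃ hs : g ∈ S, (⟨g, hs⟩ : S) ∈ derivedSeries S b := by
  obtain ⟨s, hs, rfl⟩ := ds_add_le S a b h hg
  exact ⟨s.2, hs⟩

/-- Minimal normal subgroups. -/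
def MinNormal {G : Type*} [Group G] (N : Subgroup G) : Prop :=
  N.Normal ∧ N ≠ ⊥ ∧ ∀ K : Subgroup G, K.Normal → K ≤ N → K = ⊥ ∨ K = N

theorem exists_minNormal_le {G : Type*} [Group G] [Finite G] (K : Subgroup G) (hK : K.Normal)
    (hK1 : K ≠ ⊥) : ∃ N, MinNormal N ∧ N ≤ K := by
  obtain ⟨N, hNK, hN⟩ := Set.Finite.exists_le_minimal
    (Set.toFinite {N : Subgroup G | N.Normal ∧ N ≠ ⊥}) (a := K) ⟨hK, hK1⟩
  refine ⟨N, ⟨hN.1.1, hN.1.2, fun L hL hLN => ?_⟩, hNK⟩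
  by_cases h : L = ⊥
  · exact Or.inl h
  · exact Or.inr (le_antisymm hLN (hN.2 ⟨hL, h⟩ hLN))

theorem MinNormal.comm {G : Type*} [Group G] [Finite G] [Group.IsSolvable G] {N : Subgroup G}
    (hN : MinNormal N) {x y : G} (hx : x ∈ N) (hy : y ∈ N) : x * y = y * x := by
  have := hN.1
  have hlt : ⁅N, N⁆ < N := Group.IsSolvable.commutator_lt_of_ne_bot hN.2.1
  rcases hN.2.2 ⁅N, N⁆ inferInstance hlt.le with h | h
  · have := Subgroup.commutator_mem_commutator hx hy
    rw [h, Subgroup.mem_bot] at this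
    exact commutatorElement_eq_one_iff_mul_comm.mp this
  · exact absurd h hlt.ne

theorem MinNormal.exists_prime {G : Type*} [Group G] [Finite G] [Group.IsSolvable G] {N : Subgroup G}
    (hN : MinNormal N) : ∃ p k : ℕ, p.Prime ∧ 1 ≤ k ∧ Nat.card N = p ^ k ∧
      ∀ x ∈ N, x ^ p = 1 := by
  have hnorm := hN.1
  have hcard : Nat.card N ≠ 1 := by
    intro h
    exact hN.2.1 (Subgroup.eq_bot_of_card_eq N h)
  obtain ⟨p, hp, hpd⟩ := Nat.exists_prime_and_dvd hcard
  have := Fact.mk hp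
  let T : Subgroup G :=
    { carrier := {x | x ∈ N ∧ x ^ p = 1}
      one_mem' := ⟨N.one_mem, one_pow _⟩
      mul_mem' := by
        rintro a b ⟨ha, ha'⟩ ⟨hb, hb'⟩
        refine ⟨N.mul_mem ha hb, ?_⟩
        have : Commute a b := hN.comm ha hb
        rw [this.mul_pow, ha', hb', one_mul]
      inv_mem' := by
        rintro a ⟨ha, ha'⟩
        exact ⟨N.inv_mem ha, by rw [inv_pow, ha', inv_one]⟩ }
  have hT : T.Normal := ⟨by
    rintro n ⟨hn, hn'⟩ g
    exact ⟨hnorm.conj_mem n hn g, by rw [conj_pow, hn']; group⟩⟩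
  have hTN : T = N := by
    rcases hN.2.2 T hT (fun x hx => hx.1) with h | h
    · exfalso
      obtain ⟨x, hx⟩ := exists_prime_orderOf_dvd_card' p hpd
      have h1 : (x : G) ∈ T := ⟨x.2, by
        have := pow_orderOf_eq_one x
        rw [hx] at this
        exact_mod_cast congrArg Subtype.val this⟩
      rw [h, Subgroup.mem_bot] at h1
      have : x = 1 := Subtype.ext h1
      rw [this, orderOf_one] at hx
      exact hp.one_lt.ne hx
    · exact h
  have hpow : ∀ x ∈ N, x ^ p = 1 := fun x hx => by
    rw [← hTN] at hx; exact hx.2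
  have hpg : IsPGroup p N := fun x => ⟨1, Subtype.ext (by simpa using hpow x x.2)⟩
  obtain ⟨k, hk⟩ := IsPGroup.iff_card.mp hpg
  refine ⟨p, k, hp, ?_, hk, hpow⟩
  rcases Nat.eq_zero_or_pos k with h | h
  · subst h; simp at hk; exact absurd (by simpa using hk) hN.2.1
  · exact h

/-- Irreducible representation (explicit form). -/
def Irr {K G V : Type*} [Field K] [Group G] [AddCommGroup V] [Module K V]
    (ρ : G →* (V →ₗ[K] V)) : Prop :=
  Nontrivial V ∧ ∀ W : Submodule K V, (∀ g, ∀ w ∈ W, ρ g w ∈ W) → W = ⊥ ∨ W = ⊤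

/-- restriction of a representation to an invariant subspace -/
def resRep {K G V : Type*} [Field K] [Group G] [AddCommGroup V] [Module K V]
    (ρ : G →* (V →ₗ[K] V)) (W : Submodule K V) (hW : ∀ g, ∀ w ∈ W, ρ g w ∈ W) :
    G →* (W →ₗ[K] W) where
  toFun g := (ρ g).restrict (hW g)
  map_one' := by ext w; simp
  map_mul' a b := by ext w; simp

theorem exists_irr_sub {K G V : Type*} [Field K] [Group G] [AddCommGroup V] [Module K V]
    [FiniteDimensional K V] (ρ : G →* (V →ₗ[K] V)) (U : Submodule K V) (hU : U ≠ ⊥)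
    (hUi : ∀ g, ∀ w ∈ U, ρ g w ∈ U) :
    ∃ (W : Submodule K V) (hW : ∀ g, ∀ w ∈ W, ρ g w ∈ W), W ≤ U ∧ Irr (resRep ρ W hW) := by
  obtain ⟨W, hWU, hW⟩ := exists_minimal_le_of_wellFoundedLT
    (fun W : Submodule K V => W ≠ ⊥ ∧ ∀ g, ∀ w ∈ W, ρ g w ∈ W) U ⟨hU, hUi⟩
  refine ⟨W, hW.1.2, hWU, (Submodule.nontrivial_iff_ne_bot).mpr hW.1.1, ?_⟩
  intro X hX
  by_cases h : X = ⊥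
  · exact Or.inl h
  · right
    have h1 : X.map W.subtype ≤ W := Submodule.map_subtype_le W X
    have h2 := hW.2 (y := X.map W.subtype) ⟨by
      intro hh
      apply h
      rw [Submodule.eq_bot_iff] at hh ⊢
      intro x hx
      exact Subtype.ext (hh x ⟨x, hx, rfl⟩), by
      rintro g w ⟨x, hx, rfl⟩
      exact ⟨_, hX g x hx, rfl⟩⟩ h1
    rw [eq_top_iff]
    rintro x -
    obtain ⟨y, hy, hyx⟩ := h2 x.2
    have : y = x := Subtype.ext hyx
    exact this ▸ hy

theorem Irr.triv {K G V : Type*} [Field K] [Group G] [AddCommGroup V] [Module K V]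
    {ρ : G →* (V →ₗ[K] V)} (h : Irr ρ) (N : Subgroup G) [hN : N.Normal] (v : V) (hv : v ≠ 0)
    (hf : ∀ n ∈ N, ρ n v = v) : ∀ n ∈ N, ρ n = 1 := by
  let W : Submodule K V :=
    { carrier := {w | ∀ n ∈ N, ρ n w = w}
      add_mem' := fun ha hb n hn => by rw [map_add, ha n hn, hb n hn]
      zero_mem' := fun n _ => map_zero _
      smul_mem' := fun c x hx n hn => by rw [map_smul, hx n hn] }
  have hW : ∀ g, ∀ w ∈ W, ρ g w ∈ W := by
    intro g w hw n hn
    have h1 := hw _ (hN.conj_mem n hn g⁻¹)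
    have h2 : ρ n (ρ g w) = ρ g (ρ (g⁻¹ * n * g⁻¹⁻¹) w) := by
      rw [← Module.End.mul_apply, ← Module.End.mul_apply, ← map_mul, ← map_mul]
      congr 2; group
    rw [h2, h1]
  rcases h.2 W hW with h1 | h1
  · exfalso
    have : v ∈ W := hf
    rw [h1] at this
    exact hv (by simpa using this)
  · intro n hn
    ext w
    have : w ∈ W := by rw [h1]; trivial
    exact this n hn

/-- Every irreducible representation of degree `n` in characteristic `p` of a finite solvable
group whose order is not divisible by `D` kills the `m`-th derived subgroup. -/
def LinBd (p n D m : ℕ) : Prop :=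
  ∀ (G : Type) [Group G] [Finite G] [Group.IsSolvable G] (K : Type) [Field K] [IsAlgClosed K]
    [CharP K p] (V : Type) [AddCommGroup V] [Module K V] [FiniteDimensional K V]
    (ρ : G →* (V →ₗ[K] V)), Irr ρ → Module.finrank K V = n → ¬ D ∣ Nat.card G →
    ∀ g ∈ derivedSeries G m, ρ g = 1

/-- the `m`-th derived subgroup lies in each subgroup of index `t` -/
def PermBd (t m : ℕ) : Prop :=
  ∀ (G : Type) [Group G] [Finite G] [Group.IsSolvable G] (S : Subgroup G), S.index = t →
    derivedSeries G m ≤ S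

/-- the `m`-th derived subgroup centralizes each minimal normal subgroup of order `r ^ l` -/
def ChiefBd (r l m : ℕ) : Prop :=
  ∀ (G : Type) [Group G] [Finite G] [Group.IsSolvable G] (N : Subgroup G), MinNormal N →
    Nat.card N = r ^ l → derivedSeries G m ≤ Subgroup.centralizer N

theorem LinBd.mono {p n D m m' : ℕ} (h : LinBd p n D m) (hm : m ≤ m') : LinBd p n D m' :=
  fun G _ _ _ K _ _ _ V _ _ _ ρ h1 h2 h3 g hg =>
    h G K V ρ h1 h2 h3 g (derivedSeries_antitone _ hm hg)

theorem PermBd.mono {t m m' : ℕ} (h : PermBd t m) (hm : m ≤ m') : PermBd t m' :=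
  fun G _ _ _ S h1 => (derivedSeries_antitone _ hm).trans (h G S h1)

theorem ChiefBd.mono {r l m m' : ℕ} (h : ChiefBd r l m) (hm : m ≤ m') : ChiefBd r l m' :=
  fun G _ _ _ S h1 h2 => (derivedSeries_antitone _ hm).trans (h G S h1 h2)

theorem chief_core0 {r l D m : ℕ} [Fact r.Prime] (hl : 1 ≤ l)
    (hL : ∀ n, 1 ≤ n → n ≤ l → LinBd r n D m)
    (A : Type) [AddCommGroup A] [Finite A] [Module (ZMod r) A] (hcard : Nat.card A = r ^ l)
    (R : Type) [Group R] [Finite R] [Group.IsSolvable R] (φ : R → A →+ A)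
    (hφ1 : ∀ x, φ 1 x = x) (hφm : ∀ a b x, φ (a * b) x = φ a (φ b x))
    (hirr : ∀ H : AddSubgroup A, (∀ g, ∀ x ∈ H, φ g x ∈ H) → H = ⊥ ∨ H = ⊤)
    (hD : ¬ D ∣ Nat.card R) : ∀ g ∈ derivedSeries R m, ∀ x, φ g x = x := by
  have hr : r.Prime := Fact.out
  let K := AlgebraicClosure (ZMod r)
  have hMF : Module.Finite (ZMod r) A := Module.Finite.of_finite
  have hfr : Module.finrank (ZMod r) A = l := by
    have h1 := Module.natCard_eq_pow_finrank (K := ZMod r) (V := A)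
    rw [hcard, Nat.card_zmod] at h1
    exact (Nat.pow_right_injective hr.two_le h1).symm
  let V := A →ₗ[ZMod r] K
  have hfV : Module.finrank K V = l := by
    rw [Module.finrank_linearMap, hfr, Module.finrank_self, mul_one]
  have : Nontrivial V := Module.nontrivial_of_finrank_pos (R := K) (by omega)
  have : FiniteDimensional K V := Module.finite_of_finrank_pos (by omega)
  let act : R → (A →ₗ[ZMod r] A) := fun g => (φ g).toZModLinearMap r
  have hact : ∀ (g : R) (x : A), act g x = φ g x := fun g x => rfl
  let ρ : R →* (V →ₗ[K] V) :=
    { toFun := fun g =>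
        { toFun := fun f => f.comp (act g⁻¹)
          map_add' := fun a b => rfl
          map_smul' := fun a b => rfl }
      map_one' := by
        ext f x
        simp [hact, hφ1]
      map_mul' := by
        intro a b
        ext f x
        simp [hact, hφm] }
  have hρ : ∀ g (f : V) x, ρ g f x = f (φ g⁻¹ x) := fun g f x => rfl
  obtain ⟨W, hW, -, hWirr⟩ := exists_irr_sub ρ ⊤ top_ne_bot (fun g w _ => trivial)
  have hWpos : 1 ≤ Module.finrank K W := by
    have := hWirr.1
    exact Module.finrank_pos (R := K) (M := W)
  have hWle : Module.finrank K W ≤ l := hfV ▸ Submodule.finrank_le W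
  have key := hL _ hWpos hWle R K W (resRep ρ W hW) hWirr rfl hD
  have hWn := hWirr.1
  obtain ⟨⟨f, hfW⟩, hf0⟩ := exists_ne (0 : W)
  have hf0' : f ≠ 0 := fun h => hf0 (Subtype.ext h)
  have hfix : ∀ g ∈ derivedSeries R m, ρ g f = f := by
    intro g hg
    have := congrArg (fun T : W →ₗ[K] W => ((T ⟨f, hfW⟩ : W) : V)) (key g hg)
    exact this
  let H : AddSubgroup A :=
    { carrier := {x | ∀ f' : V, (∀ g ∈ derivedSeries R m, ρ g f' = f') → f' x = 0}
      zero_mem' := fun f' _ => map_zero f'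
      add_mem' := fun ha hb f' h => by
        rw [map_add, ha f' h, hb f' h, add_zero]
      neg_mem' := fun ha f' h => by
        rw [map_neg, ha f' h, neg_zero] }
  have hHi : ∀ g, ∀ x ∈ H, φ g x ∈ H := by
    intro g x hx f' hf'
    have := hx (ρ g⁻¹ f') (by
      intro n hn
      have h2 : ρ n (ρ g⁻¹ f') = ρ g⁻¹ (ρ (g * n * g⁻¹) f') := by
        rw [← Module.End.mul_apply, ← Module.End.mul_apply, ← map_mul, ← map_mul]
        congr 2; group
      rw [h2, hf' _ ((derivedSeries_normal R m).conj_mem n hn g)])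
    rw [hρ, inv_inv] at this
    exact this
  rcases hirr H hHi with h | h
  · intro g hg x
    have hx : φ g x - x ∈ H := by
      intro f' hf'
      have h3 := congrArg (fun u : V => u x) (hf' g⁻¹ (inv_mem hg))
      simp only [hρ, inv_inv] at h3
      rw [map_sub, h3, sub_self]
    rw [h, AddSubgroup.mem_bot] at hx
    exact sub_eq_zero.mp hx
  · exfalso
    apply hf0'
    ext x
    have : x ∈ H := by rw [h]; trivial
    exact this f hfix

theorem chief_core {r l D m : ℕ} (hr : r.Prime) (hl : 1 ≤ l)
    (hL : ∀ n, 1 ≤ n → n ≤ l → LinBd r n D m)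
    (N : Type) [CommGroup N] [Finite N] (hcard : Nat.card N = r ^ l) (hexp : ∀ x : N, x ^ r = 1)
    (R : Type) [Group R] [Finite R] [Group.IsSolvable R] (φ : R →* MulAut N)
    (hirr : ∀ H : Subgroup N, (∀ g, ∀ x ∈ H, φ g x ∈ H) → H = ⊥ ∨ H = ⊤)
    (hD : ¬ D ∣ Nat.card R) : ∀ g ∈ derivedSeries R m, φ g = 1 := by
  have := Fact.mk hr
  have hfinN : Finite (Additive N) := inferInstanceAs (Finite N)
  have key := @chief_core0 r l D m _ hl hL (Additive N) _ _
    (AddCommGroup.zmodModule (n := r) (fun x => hexp (Additive.toMul x))) hcard R _ _ _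
    (fun g => (MulEquiv.toAdditive (φ g)).toAddMonoidHom) (fun x => by simp) (fun a b x => by simp)
    (by
      intro H hH
      rcases hirr (AddSubgroup.toSubgroup' H) hH with h | h
      · left
        exact AddSubgroup.toSubgroup'.injective h
      · right
        exact AddSubgroup.toSubgroup'.injective h) hD
  intro g hg
  ext x
  exact key g hg (Additive.ofMul x)

/-- conjugation data for a minimal normal subgroup -/
theorem chief_step_aux {r l D m : ℕ} (hr : r.Prime) (hl : 1 ≤ l)
    (hL : ∀ n, 1 ≤ n → n ≤ l → LinBd r n D m)
    (G : Type) [Group G] [Finite G] [Group.IsSolvable G] (N : Subgroup G) (hN : MinNormal N)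
    (hcard : Nat.card N = r ^ l)
    (hD : D = 0 ∨ ∀ (N : Type) [CommGroup N] [Finite N], Nat.card N = r ^ l →
      (∀ x : N, x ^ r = 1) → ¬ D ∣ Nat.card (MulAut N)) :
    derivedSeries G m ≤ Subgroup.centralizer N := by
  have hnorm := hN.1
  let _ : CommGroup N := { (inferInstance : Group N) with
    mul_comm := fun a b => Subtype.ext (hN.comm a.2 b.2) }
  let φ : G →* MulAut N := MulAut.conjNormal
  obtain ⟨p, k, hp, hk, hpk, hexp⟩ := hN.exists_prime
  have hpr : p = r := by
    rw [hcard] at hpk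
    have : p ∣ r ^ l := hpk ▸ dvd_pow_self p (by omega)
    exact (Nat.prime_dvd_prime_iff_eq hp hr).mp (hp.dvd_of_dvd_pow this)
  subst hpr
  have hexp' : ∀ x : N, x ^ p = 1 := fun x => Subtype.ext (hexp x x.2)
  have := Fact.mk hr
  have hirr : ∀ H : Subgroup N, (∀ g, ∀ x ∈ H, φ g x ∈ H) → H = ⊥ ∨ H = ⊤ := by
    intro H hH
    have hn : (H.map N.subtype).Normal := ⟨by
      rintro _ ⟨x, hx, rfl⟩ g
      exact ⟨φ g x, hH g x hx, rfl⟩⟩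
    rcases hN.2.2 _ hn (Subgroup.map_subtype_le H) with h | h
    · left
      exact (Subgroup.map_eq_bot_iff_of_injective H N.subtype_injective).mp h
    · right
      rw [eq_top_iff]
      rintro x -
      have : (x : G) ∈ H.map N.subtype := by rw [h]; exact x.2
      obtain ⟨y, hy, hyx⟩ := this
      have : y = x := Subtype.ext hyx
      exact this ▸ hy
  have hsol : Group.IsSolvable φ.range := Group.isSolvable_of_surjective φ.rangeRestrict_surjective
  have hmain : ∀ g ∈ derivedSeries G m, φ g = 1 := by
    intro g hg
    have hg' : φ.rangeRestrict g ∈ derivedSeries φ.range m := ds_map_le _ m hg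
    refine chief_core hr hl hL N hcard hexp' φ.range φ.range.subtype ?_ ?_ _ hg'
    · intro H hH
      exact hirr H (fun g x hx => hH (φ.rangeRestrict g) x hx)
    · rcases hD with h | h
      · subst h
        rw [zero_dvd_iff]
        exact Nat.card_pos.ne'
      · intro hd
        exact h N hcard hexp' (hd.trans (Subgroup.card_subgroup_dvd_card _))
  intro g hg
  rw [Subgroup.mem_centralizer_iff]
  intro x hx
  have := congrArg (fun T : MulAut N => ((T ⟨x, hx⟩ : N) : G)) (hmain g hg)
  simp only [φ, MulAut.conjNormal_apply, MulAut.one_apply] at this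
  exact (mul_inv_eq_iff_eq_mul.mp this).symm

theorem chief_step {r l m : ℕ} (hr : r.Prime) (hl : 1 ≤ l)
    (hL : ∀ n, 1 ≤ n → n ≤ l → LinBd r n 0 m) : ChiefBd r l m :=
  fun G _ _ _ N hN hc => chief_step_aux hr hl hL G N hN hc (Or.inl rfl)

theorem card_mulAut_two (l : ℕ) (N : Type) [CommGroup N] [Finite N] (hcard : Nat.card N = 2 ^ l)
    (hexp : ∀ x : N, x ^ 2 = 1) : Nat.card (MulAut N) = ∏ i : Fin l, (2 ^ l - 2 ^ (i : ℕ)) := by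
  let _ : Module (ZMod 2) (Additive N) := AddCommGroup.zmodModule (n := 2) (by
    intro x
    exact hexp x.toMul)
  have hfinN : Finite (Additive N) := inferInstanceAs (Finite N)
  have hMF : Module.Finite (ZMod 2) (Additive N) := Module.Finite.of_finite
  have hfr : Module.finrank (ZMod 2) (Additive N) = l := by
    have h1 := Module.natCard_eq_pow_finrank (K := ZMod 2) (V := Additive N)
    have h2 : Nat.card (Additive N) = Nat.card N := rfl
    rw [h2, hcard, Nat.card_zmod] at h1
    exact (Nat.pow_right_injective le_rfl h1).symm
  let b := Module.finBasisOfFinrankEq (ZMod 2) (Additive N) hfr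
  have e1 : MulAut N ≃ (Additive N ≃ₗ[ZMod 2] Additive N) :=
    { toFun := fun f => { (AddMonoidHom.toZModLinearMap 2 (MulEquiv.toAdditive f).toAddMonoidHom), (MulEquiv.toAdditive f) with }
      invFun := fun f => MulEquiv.toAdditive.symm f.toAddEquiv
      left_inv := fun f => rfl
      right_inv := fun f => rfl }
  have e2 := (LinearMap.GeneralLinearGroup.generalLinearEquiv (ZMod 2) (Additive N)).symm.toEquiv
  have e3 : LinearMap.GeneralLinearGroup (ZMod 2) (Additive N) ≃ Matrix.GeneralLinearGroup (Fin l) (ZMod 2) :=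
    (Units.mapEquiv (LinearMap.toMatrixAlgEquiv b).toMulEquiv).toEquiv
  rw [Nat.card_congr (e1.trans (e2.trans e3)), Matrix.card_GL_field]
  simp

theorem chief_step27 {l m : ℕ} (hl : l = 3 ∨ l = 4)
    (hL : ∀ n, 1 ≤ n → n ≤ l → LinBd 2 n 27 m) : ChiefBd 2 l m := by
  intro G _ _ _ N hN hc
  refine chief_step_aux Nat.prime_two (by omega) hL G N hN hc (Or.inr ?_)
  intro N' _ _ h1 h2
  rw [card_mulAut_two l N' h1 h2]
  rcases hl with rfl | rfl
  · simp [Fin.prod_univ_succ]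
  · simp [Fin.prod_univ_succ]

theorem chief_two_one : ChiefBd 2 1 0 := by
  intro G _ _ _ N hN hc
  have hnorm := hN.1
  intro g _
  rw [Subgroup.mem_centralizer_iff]
  intro x hx
  by_cases h1 : x = 1
  · simp [h1]
  have hcard : Nat.card N = 2 := by simpa using hc
  have h2 : g * x * g⁻¹ ∈ N := hnorm.conj_mem x hx g
  have h3 : g * x * g⁻¹ ≠ 1 := by
    intro h; apply h1
    simpa using h
  obtain ⟨a, ha⟩ := Nat.card_eq_two_iff' (1 : N) |>.mp hcard
  have e1 := ha.2 ⟨x, hx⟩ (fun h => h1 (congrArg Subtype.val h))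
  have e2 := ha.2 ⟨_, h2⟩ (fun h => h3 (congrArg Subtype.val h))
  have := congrArg Subtype.val (e2.trans e1.symm)
  exact (mul_inv_eq_iff_eq_mul.mp this).symm

open scoped Pointwise in
theorem core_free_coatom (Q : Type) [Group Q] [Finite Q] [Group.IsSolvable Q] (M : Subgroup Q)
    (hM : IsCoatom M) (hcore : M.normalCore = ⊥) :
    ∃ q k : ℕ, q.Prime ∧ 1 ≤ k ∧ M.index = q ^ k ∧
      ∀ j, ChiefBd q k j → derivedSeries Q (j + 1) = ⊥ := by
  have htop : (⊤ : Subgroup Q) ≠ ⊥ := by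
    intro h
    exact hM.1 (le_antisymm le_top (h ▸ bot_le))
  obtain ⟨N, hN, -⟩ := exists_minNormal_le (⊤ : Subgroup Q) inferInstance htop
  have hnorm := hN.1
  have hNM : ¬ N ≤ M := by
    intro h
    have := Subgroup.normal_le_normalCore.mpr h
    rw [hcore] at this
    exact hN.2.1 (le_bot_iff.mp this)
  have hsup : N ⊔ M = ⊤ := by
    apply hM.2
    exact lt_of_le_of_ne le_sup_right (fun h => hNM (h ▸ le_sup_left))
  have hdec : ∀ g : Q, ∃ n ∈ N, ∃ m ∈ M, n * m = g := by
    intro g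
    have h1 := Subgroup.normal_mul N M
    rw [hsup] at h1
    have : g ∈ (N : Set Q) * (M : Set Q) := by rw [← h1]; trivial
    obtain ⟨n, hn, m, hm, h⟩ := this
    exact ⟨n, hn, m, hm, h⟩
  have hnormal : ∀ L : Subgroup Q, L ≤ M → (∀ x ∈ L, ∀ m ∈ M, m * x * m⁻¹ ∈ L) →
      (∀ x ∈ L, ∀ n ∈ N, n * x * n⁻¹ ∈ L) → L = ⊥ := by
    intro L hLM h1 h2
    have hL : L.Normal := ⟨by
      intro x hx g
      obtain ⟨n, hn, m, hm, rfl⟩ := hdec g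
      have := h2 _ (h1 x hx m hm) n hn
      convert this using 1
      group⟩
    have := Subgroup.normal_le_normalCore.mpr hLM
    rw [hcore] at this
    exact le_bot_iff.mp this
  have hinf : N ⊓ M = ⊥ := by
    refine hnormal _ inf_le_right ?_ ?_
    · rintro x ⟨hx, hx'⟩ m hm
      exact ⟨hnorm.conj_mem x hx m, M.mul_mem (M.mul_mem hm hx') (M.inv_mem hm)⟩
    · rintro x ⟨hx, hx'⟩ n hn
      rw [hN.comm hn hx, mul_inv_cancel_right]
      exact ⟨hx, hx'⟩
  have hCinf : Subgroup.centralizer N ⊓ M = ⊥ := by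
    refine hnormal _ inf_le_right ?_ ?_
    · rintro x ⟨hx, hx'⟩ m hm
      exact ⟨(inferInstance : (Subgroup.centralizer (N : Set Q)).Normal).conj_mem x hx m,
        M.mul_mem (M.mul_mem hm hx') (M.inv_mem hm)⟩
    · rintro x ⟨hx, hx'⟩ n hn
      rw [Subgroup.mem_centralizer_iff.mp hx n hn, mul_inv_cancel_right]
      exact ⟨hx, hx'⟩
  have hCN : Subgroup.centralizer N ≤ N := by
    intro x hx
    obtain ⟨n, hn, m, hm, rfl⟩ := hdec x
    have hnC : n ∈ Subgroup.centralizer (N : Set Q) := by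
      rw [Subgroup.mem_centralizer_iff]
      intro y hy
      exact hN.comm hy hn
    have hmC : m ∈ Subgroup.centralizer (N : Set Q) := by
      have := mul_mem (inv_mem hnC) hx
      simpa using this
    have : m ∈ Subgroup.centralizer (N : Set Q) ⊓ M := ⟨hmC, hm⟩
    rw [hCinf, Subgroup.mem_bot] at this
    rw [this, mul_one]; exact hn
  obtain ⟨q, k, hq, hk, hcard, -⟩ := hN.exists_prime
  refine ⟨q, k, hq, hk, ?_, ?_⟩
  · rw [← hcard]
    have : Subgroup.IsComplement' N M := by
      apply Subgroup.isComplement'_of_disjoint_and_mul_eq_univ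
      · exact disjoint_iff.mpr hinf
      · rw [← Subgroup.normal_mul, hsup]; rfl
    exact this.index_eq_card
  · intro j hj
    have h1 := (hj Q N hN hcard).trans hCN
    rw [derivedSeries_succ, Subgroup.commutator_eq_bot_iff_le_centralizer]
    intro x hx
    rw [Subgroup.mem_centralizer_iff]
    intro y hy
    exact hN.comm (h1 hy) (h1 hx)

theorem perm_coatom (G : Type) [Group G] [Finite G] [Group.IsSolvable G] (M : Subgroup G)
    (hM : IsCoatom M) :
    ∃ q k : ℕ, q.Prime ∧ 1 ≤ k ∧ M.index = q ^ k ∧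
      ∀ j, ChiefBd q k j → derivedSeries G (j + 1) ≤ M := by
  let π := QuotientGroup.mk' M.normalCore
  have hπ : Function.Surjective π := QuotientGroup.mk'_surjective _
  have hker : π.ker = M.normalCore := QuotientGroup.ker_mk' _
  have hcm : (M.map π).comap π = M := by
    rw [Subgroup.comap_map_eq, hker]
    exact sup_eq_left.mpr M.normalCore_le
  have hco : IsCoatom (M.map π) := by
    constructor
    · intro h
      rw [h] at hcm
      exact hM.1 (by rw [← hcm]; rfl)
    · intro L hL
      have h2 : M < L.comap π := by
        have h4 := (Subgroup.comap_lt_comap_of_surjective hπ).mpr hL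
        rwa [hcm] at h4
      have h3 := hM.2 _ h2
      rw [← Subgroup.map_comap_eq_self_of_surjective hπ L, h3]
      exact Subgroup.map_top_of_surjective π hπ
  have hcore : (M.map π).normalCore = ⊥ := by
    rw [eq_bot_iff]
    have h1 : (M.map π).normalCore.comap π ≤ M.normalCore := by
      apply Subgroup.normal_le_normalCore.mpr
      exact (Subgroup.comap_mono (Subgroup.normalCore_le _)).trans hcm.le
    intro x hx
    obtain ⟨g, rfl⟩ := hπ x
    have : g ∈ π.ker := by rw [hker]; exact h1 hx
    exact this
  obtain ⟨q, k, hq, hk, hidx, hj⟩ := core_free_coatom _ (M.map π) hco hcore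
  refine ⟨q, k, hq, hk, ?_, ?_⟩
  · have h4 := Subgroup.index_comap_of_surjective (M.map π) hπ
    rw [hcm] at h4
    rw [h4, hidx]
  · intro j hc
    intro g hg
    have := ds_map_le π (j+1) hg
    rw [hj j hc, Subgroup.mem_bot] at this
    have h5 : g ∈ (M.map π).comap π := by
      rw [Subgroup.mem_comap, this]
      exact one_mem _
    rwa [hcm] at h5

/-- superadditivity of floor log -/
theorem lg_mul (a b : ℕ) (ha : a ≠ 0) (hb : b ≠ 0) :
    Nat.log 9 a + Nat.log 9 b ≤ Nat.log 9 (a * b) := by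
  apply Nat.le_log_of_pow_le (by norm_num)
  rw [pow_add]
  exact Nat.mul_le_mul (Nat.pow_log_le_self 9 ha) (Nat.pow_log_le_self 9 hb)

theorem perm_gen (T : ℕ) (hT : ∀ q k : ℕ, q.Prime → 1 ≤ k → q ^ k ≤ T →
    ∃ j, ChiefBd q k j ∧ j + 1 ≤ Nat.log 9 ((q ^ k) ^ 5)) :
    ∀ t, 1 ≤ t → t ≤ T → PermBd t (Nat.log 9 (t ^ 5)) := by
  intro t
  induction t using Nat.strong_induction_on with
  | _ t ih =>
    intro ht1 htT G _ _ _ S hS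
    by_cases hS1 : S = ⊤
    · rw [hS1]; exact le_top
    obtain ⟨M, hM, hSM⟩ := (eq_top_or_exists_le_coatom S).resolve_left hS1
    obtain ⟨q, k, hq, hk, hidx, hj⟩ := perm_coatom G M hM
    have hmul : (S.subgroupOf M).index * M.index = t := by
      rw [← hS]; exact Subgroup.relIndex_mul_index hSM
    have hpos : 1 ≤ (S.subgroupOf M).index := by
      apply Nat.one_le_iff_ne_zero.mpr; intro h; rw [h] at hmul; omega
    have hM2 : 2 ≤ M.index := by
      rw [hidx]; exact hq.two_le.trans (Nat.le_self_pow (by omega) q)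
    have hMT : M.index ≤ T := by nlinarith
    obtain ⟨j, hjc, hjl⟩ := hT q k hq hk (hidx ▸ hMT)
    have h2 := ih _ (by nlinarith) hpos (by nlinarith) M (S.subgroupOf M) rfl
    have h1 := (derivedSeries_antitone G hjl).trans' le_rfl |>.trans (hj j hjc)
    intro g hg
    have hle : Nat.log 9 ((q ^ k) ^ 5) + Nat.log 9 ((S.subgroupOf M).index ^ 5) ≤
        Nat.log 9 (t ^ 5) := by
      refine (lg_mul _ _ ?_ ?_).trans (le_of_eq ?_)
      · have := hq.pos; positivity
      · positivity
      · rw [← mul_pow, ← hidx, mul_comm, hmul]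
    obtain ⟨hs, hs'⟩ := ds_add_mem M _ _ h1 (derivedSeries_antitone G hle hg)
    exact Subgroup.mem_subgroupOf.mp (h2 hs')

section weights
variable {K G V : Type} [Field K] [Group G] [AddCommGroup V] [Module K V]

/-- weight space -/
def wt (ρ : G →* (V →ₗ[K] V)) (A : Subgroup G) (χ : G → K) : Submodule K V where
  carrier := {v | ∀ a ∈ A, ρ a v = χ a • v}
  add_mem' := fun ha hb n hn => by rw [map_add, ha n hn, hb n hn, smul_add]
  zero_mem' := fun n _ => by simp
  smul_mem' := fun c x hx n hn => by rw [map_smul, hx n hn, smul_comm]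

theorem exists_weight [IsAlgClosed K] [FiniteDimensional K V] [Nontrivial V]
    (ρ : G →* (V →ₗ[K] V)) (A : Subgroup G)
    (hcomm : ∀ a ∈ A, ∀ b ∈ A, ρ a * ρ b = ρ b * ρ a) : ∃ χ : G → K, wt ρ A χ ≠ ⊥ := by
  obtain ⟨W, hW, -, hWirr⟩ := exists_irr_sub (ρ.comp A.subtype) ⊤ top_ne_bot (fun g w _ => trivial)
  have hWn := hWirr.1
  have hsc : ∀ a ∈ A, ∃ c : K, ∀ w ∈ W, ρ a w = c • w := by
    intro a ha
    obtain ⟨c, hc⟩ := Module.End.exists_eigenvalue (resRep (ρ.comp A.subtype) W hW ⟨a, ha⟩)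
    refine ⟨c, ?_⟩
    rcases hWirr.2 (Module.End.eigenspace (resRep (ρ.comp A.subtype) W hW ⟨a, ha⟩) c) (by
      intro b w hw
      rw [Module.End.mem_eigenspace_iff] at hw ⊢
      have h1 : resRep (ρ.comp A.subtype) W hW ⟨a, ha⟩ * resRep (ρ.comp A.subtype) W hW b =
          resRep (ρ.comp A.subtype) W hW b * resRep (ρ.comp A.subtype) W hW ⟨a, ha⟩ := by
        ext x
        exact congrArg (fun T : V →ₗ[K] V => T x) (hcomm a ha b b.2)
      rw [← Module.End.mul_apply, h1, Module.End.mul_apply, hw, map_smul]) with h | h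
    · exact absurd h hc
    · intro w hw
      have : (⟨w, hw⟩ : W) ∈ Module.End.eigenspace (resRep (ρ.comp A.subtype) W hW ⟨a, ha⟩) c := by
        rw [h]; trivial
      rw [Module.End.mem_eigenspace_iff] at this
      exact congrArg Subtype.val this
  classical
  choose! χ hχ using hsc
  refine ⟨χ, ?_⟩
  obtain ⟨⟨w, hw⟩, hw0⟩ := exists_ne (0 : W)
  intro h
  have : w ∈ wt ρ A χ := fun a ha => hχ a ha w hw
  rw [h, Submodule.mem_bot] at this
  exact hw0 (Subtype.ext this)

theorem wt_indep (ρ : G →* (V →ₗ[K] V)) (A : Subgroup G) {ι : Type} (χ : ι → G → K)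
    (hχ : ∀ i j, i ≠ j → ∃ a ∈ A, χ i a ≠ χ j a) (s : Finset ι) :
    ∀ v : ι → V, (∀ i ∈ s, v i ∈ wt ρ A (χ i)) → ∑ i ∈ s, v i = 0 → ∀ i ∈ s, v i = 0 := by
  classical
  induction s using Finset.induction_on with
  | empty => simp
  | insert j s hj ih =>
    intro v hv hsum
    have h1 : ∀ i ∈ s, v i = 0 := by
      intro i hi
      obtain ⟨a, ha, hne⟩ := hχ i j (fun h => hj (h ▸ hi))
      have h2 := ih (fun i => (χ i a - χ j a) • v i)
        (fun i hi => Submodule.smul_mem _ _ (hv i (Finset.mem_insert_of_mem hi))) (by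
          have h3 := congrArg (ρ a) hsum
          rw [map_zero, map_sum, Finset.sum_congr rfl
            (fun i hi => hv i hi a ha), Finset.sum_insert hj] at h3
          have h4 := congrArg (fun v => χ j a • v) hsum
          simp only [smul_zero, Finset.sum_insert hj, smul_add, Finset.smul_sum] at h4
          simp only [sub_smul, Finset.sum_sub_distrib]
          rw [sub_eq_zero]
          exact add_left_cancel (h3.trans h4.symm)) i hi
      exact (smul_eq_zero.mp h2).resolve_left (sub_ne_zero.mpr hne)
    intro i hi
    rcases Finset.mem_insert.mp hi with rfl | hi
    · rw [Finset.sum_insert hj, Finset.sum_eq_zero h1, add_zero] at hsum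
      exact hsum
    · exact h1 i hi

theorem wt_sum_le [FiniteDimensional K V] (ρ : G →* (V →ₗ[K] V)) (A : Subgroup G) {ι : Type}
    [Fintype ι] (χ : ι → G → K) (hχ : ∀ i j, i ≠ j → ∃ a ∈ A, χ i a ≠ χ j a) :
    ∑ i, Module.finrank K (wt ρ A (χ i)) ≤ Module.finrank K V := by
  rw [← Module.finrank_pi_fintype K]
  let f : (∀ i, wt ρ A (χ i)) →ₗ[K] V := ∑ i, (wt ρ A (χ i)).subtype.comp (LinearMap.proj i)
  apply LinearMap.finrank_le_finrank_of_injective (f := f)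
  rw [← LinearMap.ker_eq_bot, LinearMap.ker_eq_bot']
  intro v hv
  have h := wt_indep ρ A χ hχ Finset.univ (fun i => (v i : V)) (fun i _ => (v i).2) (by
    simpa [f] using hv)
  ext i
  exact h i (Finset.mem_univ i)

end weights

theorem imprim {p n D m : ℕ} (hm : ∀ t d, 2 ≤ t → 1 ≤ d → t * d ≤ n →
      ∃ m1 m2, PermBd t m1 ∧ LinBd p d D m2 ∧ m1 + m2 ≤ m)
    (G : Type) [Group G] [Finite G] [Group.IsSolvable G] (K : Type) [Field K] [IsAlgClosed K]
    [CharP K p] (V : Type) [AddCommGroup V] [Module K V] [FiniteDimensional K V]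
    (ρ : G →* (V →ₗ[K] V)) (hirr : Irr ρ) (hn : Module.finrank K V = n) (hD : ¬ D ∣ Nat.card G)
    (A : Subgroup G) (hA : A.Normal) (hcomm : ∀ a ∈ A, ∀ b ∈ A, ρ a * ρ b = ρ b * ρ a)
    (hns : ¬ ∀ a ∈ A, ∃ c : K, ρ a = c • 1) :
    ∀ g ∈ derivedSeries G m, ρ g = 1 := by
  have hVn := hirr.1
  obtain ⟨χ, hχ⟩ := exists_weight ρ A hcomm
  have hmove : ∀ g, ∀ v ∈ wt ρ A χ, ρ g v ∈ wt ρ A (fun a => χ (g⁻¹ * a * g)) := by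
    intro g v hv a ha
    have h1 := hv (g⁻¹ * a * g) (by simpa using hA.conj_mem a ha g⁻¹)
    have h2 : ρ a (ρ g v) = ρ g (ρ (g⁻¹ * a * g) v) := by
      rw [← Module.End.mul_apply, ← Module.End.mul_apply, ← map_mul, ← map_mul]
      congr 2; group
    rw [h2, h1, map_smul]
  let S : Subgroup G :=
    { carrier := {g | ∀ a ∈ A, χ (g⁻¹ * a * g) = χ a}
      one_mem' := fun a _ => by simp
      mul_mem' := by
        intro g h hg hh a ha
        have h1 := hh (g⁻¹ * a * g) (by simpa using hA.conj_mem a ha g⁻¹)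
        rw [hg a ha] at h1
        rw [← h1]
        congr 1; group
      inv_mem' := by
        intro g hg a ha
        have h1 := hg (g * a * g⁻¹) (hA.conj_mem a ha g)
        rw [inv_inv, ← h1]
        congr 1; group }
  have hWS : ∀ g ∈ S, ∀ v ∈ wt ρ A χ, ρ g v ∈ wt ρ A χ := by
    intro g hg v hv a ha
    rw [hmove g v hv a ha]
    exact congrArg (fun c => c • ρ g v) (hg a ha)
  have hS : S ≠ ⊤ := by
    intro hS
    rcases hirr.2 (wt ρ A χ) (fun g v hv => hWS g (hS ▸ trivial) v hv) with h | h
    · exact hχ h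
    · apply hns
      intro a ha
      refine ⟨χ a, ?_⟩
      ext v
      have : v ∈ wt ρ A χ := h ▸ trivial
      exact this a ha
  have hinj : ∀ g, Function.Injective (ρ g) := by
    intro g
    apply Function.LeftInverse.injective (g := ρ g⁻¹)
    intro v
    rw [← Module.End.mul_apply, ← map_mul]; simp
  have hidx : S.index * Module.finrank K (wt ρ A χ) ≤ n := by
    have := Fintype.ofFinite (G ⧸ S)
    have h1 := wt_sum_le ρ A (ι := G ⧸ S) (fun q a => χ (q.out⁻¹ * a * q.out)) (by
      intro q q' hne
      by_contra hcon
      push Not at hcon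
      apply hne
      rw [← QuotientGroup.out_eq' q, ← QuotientGroup.out_eq' q', QuotientGroup.eq]
      intro b hb
      have h2 := hcon (q.out * b * q.out⁻¹) (hA.conj_mem b hb _)
      rw [show q.out⁻¹ * (q.out * b * q.out⁻¹) * q.out = b by group] at h2
      rw [h2]
      congr 1; group)
    rw [hn] at h1
    refine le_trans ?_ h1
    rw [Subgroup.index, Nat.card_eq_fintype_card, ← Finset.card_univ, ← smul_eq_mul]
    apply Finset.card_nsmul_le_sum
    intro q _
    have h3 : (wt ρ A χ).map (ρ q.out) ≤ wt ρ A (fun a => χ (q.out⁻¹ * a * q.out)) := by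
      rintro _ ⟨v, hv, rfl⟩
      exact hmove _ v hv
    calc _ = Module.finrank K ((wt ρ A χ).map (ρ q.out)) :=
          (LinearEquiv.finrank_eq (Submodule.equivMapOfInjective _ (hinj _) _))
      _ ≤ _ := Submodule.finrank_mono h3
  obtain ⟨W, hW, hWle, hWirr⟩ := exists_irr_sub (ρ.comp S.subtype) (wt ρ A χ) hχ
    (fun g w hw => hWS g g.2 w hw)
  have hWn := hWirr.1
  have hWpos : 1 ≤ Module.finrank K W := Module.finrank_pos (R := K) (M := W)
  have ht : 2 ≤ S.index := by
    have h1 : S.index ≠ 1 := fun h => hS (Subgroup.index_eq_one.mp h)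
    have h2 : S.index ≠ 0 := Subgroup.index_ne_zero_of_finite
    omega
  obtain ⟨m1, m2, hP, hL, hle⟩ := hm S.index (Module.finrank K W) ht hWpos
    ((Nat.mul_le_mul_left _ (Submodule.finrank_mono hWle)).trans hidx)
  have h1 := hP G S rfl
  have h2 := hL S K W _ hWirr rfl (fun h => hD (h.trans (Subgroup.card_subgroup_dvd_card S)))
  obtain ⟨⟨w, hw⟩, hw0⟩ := exists_ne (0 : W)
  refine hirr.triv (derivedSeries G m) w (fun h => hw0 (Subtype.ext h)) ?_
  intro g hg
  obtain ⟨hs, hs'⟩ := ds_add_mem S m1 m2 h1 (derivedSeries_antitone G hle hg)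
  have h3 := congrArg (fun T : W →ₗ[K] W => ((T ⟨w, hw⟩ : W) : V)) (h2 ⟨g, hs⟩ hs')
  exact h3

theorem char_count {ι E K : Type} [Field K] [Finite ι] [Group E] [Finite E] (H : Subgroup E)
    (f : ι → (E →* K)) (hinj : Function.Injective f) (hH : ∀ i, ∀ h ∈ H, f i h = 1) :
    Nat.card ι ≤ H.index := by
  have := Fintype.ofFinite ι
  have := Fintype.ofFinite (E ⧸ H)
  have h1 : LinearIndependent K (fun i : ι => (f i : E → K)) :=
    (linearIndependent_monoidHom E K).comp f hinj
  have hout : ∀ (i : ι) (e : E), f i ((e : E ⧸ H).out) = f i e := by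
    intro i e
    obtain ⟨h, hh⟩ := QuotientGroup.mk_out_eq_mul H e
    rw [hh, map_mul, hH i h h.2, mul_one]
  have h2 : LinearIndependent K (fun (i : ι) (q : E ⧸ H) => f i q.out) := by
    apply LinearIndependent.of_comp (LinearMap.funLeft K K (fun e : E => (e : E ⧸ H)))
    convert h1 using 1
    ext i e
    simp [LinearMap.funLeft_apply, hout]
  have h3 := h2.fintype_card_le_finrank
  rw [Module.finrank_fintype_fun_eq_card] at h3
  rw [Subgroup.index, Nat.card_eq_fintype_card, Nat.card_eq_fintype_card]
  exact h3

/-- elements commuting with a set under a representation -/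
def cen {G M : Type} [Group G] [Monoid M] (ρ : G →* M) (X : Set G) : Subgroup G where
  carrier := {g | ∀ x ∈ X, Commute (ρ g) (ρ x)}
  one_mem' := fun x _ => by rw [map_one]; exact Commute.one_left _
  mul_mem' := fun ha hb x hx => by rw [map_mul]; exact (ha x hx).mul_left (hb x hx)
  inv_mem' := fun {a} ha x hx => by
    have h := ha x hx
    have e1 : ρ a * ρ a⁻¹ = 1 := by rw [← map_mul]; simp
    have e2 : ρ a⁻¹ * ρ a = 1 := by rw [← map_mul]; simp
    calc ρ a⁻¹ * ρ x = ρ a⁻¹ * (ρ x * ρ a) * ρ a⁻¹ := by rw [mul_assoc, mul_assoc, e1, mul_one]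
      _ = ρ x * ρ a⁻¹ := by rw [← h.eq, ← mul_assoc, e2, one_mul]

theorem cen_closure {G M : Type} [Group G] [Monoid M] (ρ : G →* M) (X : Set G)
    (h : ∀ x ∈ X, ∀ y ∈ X, Commute (ρ x) (ρ y)) :
    ∀ x ∈ Subgroup.closure X, ∀ y ∈ Subgroup.closure X, Commute (ρ x) (ρ y) := by
  have h1 : Subgroup.closure X ≤ cen ρ X := (Subgroup.closure_le _).mpr h
  have h2 : Subgroup.closure X ≤ cen ρ (Subgroup.closure X) :=
    (Subgroup.closure_le _).mpr (fun x hx y hy => (h1 hy x hx).symm)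
  exact fun x hx y hy => h2 hx y hy

theorem rep_ne_zero {K A V : Type} [Field K] [Group A] [AddCommGroup V] [Module K V]
    [Nontrivial V] (ρ : A →* (V →ₗ[K] V)) (a : A) : ρ a ≠ 0 := by
  intro h
  have : ρ a * ρ a⁻¹ = 1 := by rw [← map_mul]; simp
  rw [h, zero_mul] at this
  exact zero_ne_one this

theorem count {K A V : Type} [Field K] [IsAlgClosed K] [Group A] [Finite A] [AddCommGroup V]
    [Module K V] [FiniteDimensional K V] [Nontrivial V] (ρ : A →* (V →ₗ[K] V))
    (hsc : ∀ a b, ∃ c : K, ρ a * ρ b = c • (ρ b * ρ a)) (Z : Subgroup A)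
    (hZ : ∀ z, z ∈ Z ↔ ∀ a, Commute (ρ z) (ρ a)) :
    ∃ x, Z.index = x * x ∧ x ≤ Module.finrank K V := by
  choose c hc using hsc
  have huniq : ∀ a b x, ρ a * ρ b = x • (ρ b * ρ a) → c a b = x := by
    intro a b x h
    rw [hc] at h
    have h1 : (c a b - x) • (ρ (b * a)) = 0 := by rw [map_mul, sub_smul, h, sub_self]
    exact sub_eq_zero.mp ((smul_eq_zero.mp h1).resolve_right (rep_ne_zero ρ _))
  have hcomm : ∀ a b, c a b = 1 ↔ Commute (ρ a) (ρ b) := by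
    intro a b
    constructor
    · intro h
      have := hc a b
      rwa [h, one_smul] at this
    · intro h
      apply huniq
      rw [one_smul]; exact h
  have hmul : ∀ a a' b, c (a * a') b = c a b * c a' b := by
    intro a a' b
    apply huniq
    rw [map_mul, mul_assoc, hc a' b, mul_smul_comm, ← mul_assoc, hc a b, smul_mul_assoc, smul_smul,
      mul_assoc, mul_comm (c a' b)]
  have hmul' : ∀ a b b', c a (b * b') = c a b * c a b' := by
    intro a b b'
    apply huniq
    rw [map_mul, ← mul_assoc, hc a b, smul_mul_assoc, mul_assoc, hc a b', mul_smul_comm, smul_smul,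
      mul_assoc]
  have hone : ∀ a, c 1 a = 1 := fun a => (hcomm 1 a).mpr (by rw [map_one]; exact Commute.one_left _)
  have hone' : ∀ a, c a 1 = 1 := fun a => (hcomm a 1).mpr (by rw [map_one]; exact Commute.one_right _)
  have hinv : ∀ a b, c a⁻¹ b * c a b = 1 := fun a b => by rw [← hmul]; simp [hone]
  have hsep : ∀ a b x, c a x = c b x → c (a⁻¹ * b) x = 1 := by
    intro a b x h
    rw [hmul, ← h, hinv]
  obtain ⟨E, hE⟩ := Set.Finite.exists_maximal
    (Set.toFinite {E : Subgroup A | ∀ x ∈ E, ∀ y ∈ E, Commute (ρ x) (ρ y)})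
    ⟨⊥, by
      intro x hx y hy
      rw [Subgroup.mem_bot] at hx hy
      rw [hx, hy]⟩
  have hEc : ∀ x ∈ E, ∀ y ∈ E, c x y = 1 := fun x hx y hy => (hcomm x y).mpr (hE.1 x hx y hy)
  have hEmax : ∀ a, (∀ e ∈ E, c a e = 1) → a ∈ E := by
    intro a ha
    have h1 := cen_closure ρ (insert a (E : Set A)) (by
      intro x hx y hy
      rcases hx with rfl | hx <;> rcases hy with rfl | hy
      · exact Commute.refl _
      · exact (hcomm _ _).mp (ha y hy)
      · exact ((hcomm _ _).mp (ha x hx)).symm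
      · exact hE.1 x hx y hy)
    have h2 := hE.2 h1 (fun x hx => Subgroup.subset_closure (Set.mem_insert_of_mem _ hx))
    exact h2 (Subgroup.subset_closure (Set.mem_insert _ _))
  have hZE : Z ≤ E := fun z hz => hEmax z (fun e _ => (hcomm z e).mpr ((hZ z).mp hz e))
  let f1 : A → (E →* K) := fun a =>
    { toFun := fun e => c a e
      map_one' := hone' a
      map_mul' := fun x y => hmul' a x y }
  let f2 : A → (A →* K) := fun e =>
    { toFun := fun a => c e a
      map_one' := hone' e
      map_mul' := fun x y => hmul' e x y }
  have hsw : ∀ a b, c a b * c b a = 1 := by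
    intro a b
    have h := hc a b
    rw [hc b a, smul_smul] at h
    have h1 : (c a b * c b a - 1) • (ρ (a * b)) = 0 := by
      rw [map_mul, sub_smul, ← h, one_smul, sub_self]
    exact sub_eq_zero.mp ((smul_eq_zero.mp h1).resolve_right (rep_ne_zero ρ _))
  have hle1 : E.index ≤ (Z.subgroupOf E).index := by
    refine char_count (ι := A ⧸ E) (Z.subgroupOf E) (fun q => f1 q.out) ?_ ?_
    · intro q q' h
      rw [← QuotientGroup.out_eq' q, ← QuotientGroup.out_eq' q', QuotientGroup.eq]
      apply hEmax
      intro e he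
      exact hsep _ _ _ (DFunLike.congr_fun h ⟨e, he⟩)
    · intro q h hh
      have h1 : c h q.out = 1 := (hcomm _ _).mpr ((hZ h).mp (Subgroup.mem_subgroupOf.mp hh) _)
      have h2 := hsw q.out h
      rw [h1, mul_one] at h2
      exact h2
  have hle2 : (Z.subgroupOf E).index ≤ E.index := by
    refine char_count (ι := E ⧸ Z.subgroupOf E) E (fun q => f2 q.out) ?_ ?_
    · intro q q' h
      rw [← QuotientGroup.out_eq' q, ← QuotientGroup.out_eq' q', QuotientGroup.eq,
        Subgroup.mem_subgroupOf, hZ]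
      intro a
      rw [← hcomm]
      exact hsep _ _ _ (DFunLike.congr_fun h a)
    · intro q h hh
      exact hEc _ q.out.2 _ hh
  refine ⟨E.index, ?_, ?_⟩
  · rw [← Subgroup.relIndex_mul_index hZE]
    congr 1
    exact le_antisymm hle2 hle1
  · obtain ⟨χ, hχ⟩ := exists_weight ρ E (fun a ha b hb => hE.1 a ha b hb)
    have := Fintype.ofFinite (A ⧸ E)
    have hmv : ∀ a : A, ∀ v ∈ wt ρ E χ, ρ a v ∈ wt ρ E (fun e => c e a * χ e) := by
      intro a v hv e he
      rw [← Module.End.mul_apply, hc e a, LinearMap.smul_apply, Module.End.mul_apply, hv e he,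
        map_smul, smul_smul]
    have hχ0 : ∀ e ∈ E, χ e ≠ 0 := by
      intro e he h0
      apply hχ
      rw [Submodule.eq_bot_iff]
      intro v hv
      have h1 := hv e he
      rw [h0, zero_smul] at h1
      have : ρ e⁻¹ (ρ e v) = v := by rw [← Module.End.mul_apply, ← map_mul]; simp
      rw [← this, h1, map_zero]
    have h1 := wt_sum_le ρ E (ι := A ⧸ E) (fun q e => c e q.out * χ e) (by
      intro q q' hne
      by_contra hcon
      push Not at hcon
      apply hne
      rw [← QuotientGroup.out_eq' q, ← QuotientGroup.out_eq' q', QuotientGroup.eq]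
      apply hEmax
      intro e he
      apply hsep
      have h2 := mul_right_cancel₀ (hχ0 e he) (hcon e he)
      have h3 := hsw q.out e
      have h4 := hsw q'.out e
      rw [← h2] at h4
      have h5 : c e q.out ≠ 0 := right_ne_zero_of_mul_eq_one h3
      exact mul_right_cancel₀ h5 (h3.trans h4.symm))
    refine le_trans ?_ h1
    rw [Subgroup.index, Nat.card_eq_fintype_card, ← Finset.card_univ, Finset.card_eq_sum_ones]
    apply Finset.sum_le_sum
    intro q _
    obtain ⟨v, hv, hv0⟩ := (Submodule.ne_bot_iff _).mp hχ
    have hnt : Nontrivial (wt ρ E (fun e => c e q.out * χ e)) := by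
      rw [Submodule.nontrivial_iff_ne_bot, Submodule.ne_bot_iff]
      refine ⟨ρ q.out v, hmv _ v hv, ?_⟩
      intro h
      apply hv0
      have : ρ q.out⁻¹ (ρ q.out v) = v := by rw [← Module.End.mul_apply, ← map_mul]; simp
      rw [← this, h, map_zero]
    exact Module.finrank_pos (R := K) (M := wt ρ E (fun e => c e q.out * χ e))

open scoped commutatorElement

theorem rho_comm_eq_one {G M : Type} [Group G] [Monoid M] (ρ : G →* M) {g h : G}
    (hc : Commute (ρ g) (ρ h)) : ρ ⁅g, h⁆ = 1 := by
  have h1 : ρ ⁅g, h⁆ = ρ g * ρ h * ρ (g⁻¹ * h⁻¹) := by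
    rw [← map_mul, ← map_mul]; congr 1; rw [commutatorElement_def]; group
  rw [h1, hc.eq, ← map_mul, ← map_mul]
  convert map_one ρ using 2
  group

theorem scal_of_comm {K G V : Type} [Field K] [Group G] [AddCommGroup V] [Module K V]
    (ρ : G →* (V →ₗ[K] V)) {d a : G} {c : K} (h : ρ ⁅d, a⁆ = c • 1) :
    ρ d * ρ a = c • (ρ a * ρ d) := by
  have h1 : ρ d * ρ a = ρ ⁅d, a⁆ * (ρ a * ρ d) := by
    rw [← map_mul, ← map_mul, ← map_mul]; congr 1; rw [commutatorElement_def]; group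
  rw [h1, h, smul_mul_assoc, one_mul]

theorem comm_of_scal {K G V : Type} [Field K] [Group G] [AddCommGroup V] [Module K V] [Nontrivial V]
    (ρ : G →* (V →ₗ[K] V)) {d d' a : G} {c c' : K} (h : ρ d * ρ a = c • (ρ a * ρ d))
    (h' : ρ d' * ρ a = c' • (ρ a * ρ d')) : Commute (ρ ⁅d, d'⁆) (ρ a) := by
  have h1 : ρ (d * d') * ρ a = (c * c') • (ρ a * ρ (d * d')) := by
    rw [map_mul, mul_assoc, h', mul_smul_comm, ← mul_assoc, h, smul_mul_assoc, smul_smul,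
      mul_assoc, mul_comm c']
  have h2 : ρ (d' * d) * ρ a = (c * c') • (ρ a * ρ (d' * d)) := by
    rw [map_mul, mul_assoc, h, mul_smul_comm, ← mul_assoc, h', smul_mul_assoc, smul_smul,
      mul_assoc]
  have hne : c * c' ≠ 0 := by
    intro h0
    rw [h0, zero_smul, ← map_mul] at h1
    exact rep_ne_zero ρ _ h1
  have h3 : ρ (d * d') = ρ ⁅d, d'⁆ * ρ (d' * d) := by
    rw [← map_mul]; congr 1; rw [commutatorElement_def]; group
  have h4 : ρ (d' * d) * ρ (d' * d)⁻¹ = 1 := by rw [← map_mul]; simp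
  rw [h3, mul_assoc, h2, mul_smul_comm] at h1
  have h5 := smul_right_injective _ hne h1
  have h6 := congrArg (fun T => T * ρ (d' * d)⁻¹) h5
  simp only [mul_assoc, h4, mul_one] at h6
  exact h6

theorem lin_step {p n D m : ℕ} (hp : p.Prime) (hm1 : 1 ≤ m)
    (himp : ∀ t d, 2 ≤ t → 1 ≤ d → t * d ≤ n →
      ∃ m1 m2, PermBd t m1 ∧ LinBd p d D m2 ∧ m1 + m2 ≤ m)
    (hprim : ∀ r k, r.Prime → r ≠ p → 1 ≤ k → r ^ k ≤ n → ¬ D ∣ r ^ (2 * k + 1) →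
      ∃ j, ChiefBd r (2 * k) j ∧ j + 2 ≤ m) : LinBd p n D m := by
  intro G _ _ _ K _ _ _ V _ _ _ ρ hirr hn hD
  have hVn := hirr.1
  let Z : Subgroup G :=
    { carrier := {g | ∃ c : K, ρ g = c • 1}
      one_mem' := ⟨1, by rw [map_one, one_smul]⟩
      mul_mem' := by
        rintro a b ⟨c, hc⟩ ⟨c', hc'⟩
        exact ⟨c * c', by rw [map_mul, hc, hc', smul_mul_smul_comm, one_mul]⟩
      inv_mem' := by
        rintro a ⟨c, hc⟩
        have h1 : ρ a * ρ a⁻¹ = 1 := by rw [← map_mul]; simp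
        rw [hc, smul_mul_assoc, one_mul] at h1
        have hc0 : c ≠ 0 := by rintro rfl; rw [zero_smul] at h1; exact zero_ne_one h1
        exact ⟨c⁻¹, by rw [← h1, smul_smul, inv_mul_cancel₀ hc0, one_smul]⟩ }
  have hZc : ∀ z ∈ Z, ∀ g, Commute (ρ z) (ρ g) := by
    rintro z ⟨c, hc⟩ g
    rw [hc]
    exact (Commute.one_left _).smul_left c
  have hZn : Z.Normal := ⟨by
    rintro z ⟨c, hc⟩ g
    refine ⟨c, ?_⟩
    rw [map_mul, map_mul, hc, mul_smul_comm, mul_one, smul_mul_assoc, ← map_mul]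
    simp⟩
  by_cases hA : ∃ A : Subgroup G, A.Normal ∧ (∀ a ∈ A, ∀ b ∈ A, ρ a * ρ b = ρ b * ρ a) ∧
      ¬ ∀ a ∈ A, ∃ c : K, ρ a = c • 1
  · obtain ⟨A, hA1, hA2, hA3⟩ := hA
    exact imprim himp G K V ρ hirr hn hD A hA1 hA2 hA3
  have hpr : ∀ A : Subgroup G, A.Normal → (∀ a ∈ A, ∀ b ∈ A, ρ a * ρ b = ρ b * ρ a) → A ≤ Z := by
    intro A h1 h2
    by_contra h3
    exact hA ⟨A, h1, h2, h3⟩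
  obtain ⟨m', rfl⟩ : ∃ m', m = m' + 1 := ⟨m - 1, by omega⟩
  suffices hmain : derivedSeries G m' ≤ Z by
    have : derivedSeries G (m' + 1) ≤ ρ.ker := by
      rw [derivedSeries_succ, Subgroup.commutator_le]
      intro g hg h hh
      exact rho_comm_eq_one ρ (hZc g (hmain hg) h)
    exact fun g hg => this hg
  by_contra hcon
  let π := QuotientGroup.mk' Z
  have hπ : Function.Surjective π := QuotientGroup.mk'_surjective _
  have hker : π.ker = Z := QuotientGroup.ker_mk' _
  have hDn : ((derivedSeries G m').map π).Normal := Subgroup.Normal.map inferInstance π hπ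
  obtain ⟨N, hN, hND⟩ := exists_minNormal_le ((derivedSeries G m').map π) hDn (by
    intro h
    rw [Subgroup.map_eq_bot_iff, hker] at h
    exact hcon h)
  have hNn := hN.1
  let A := N.comap π
  have hAn : A.Normal := inferInstance
  have hZA : Z ≤ A := by
    intro z hz
    have : π z = 1 := by rw [← hker] at hz; exact hz
    change π z ∈ N
    rw [this]; exact one_mem _
  have hAZ : ¬ A ≤ Z := by
    intro h
    apply hN.2.1
    rw [eq_bot_iff]
    intro x hx
    obtain ⟨g, rfl⟩ := hπ x
    have : g ∈ π.ker := by rw [hker]; exact h hx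
    exact this
  have hZmem : ∀ g, π g = 1 → g ∈ Z := fun g hg => by rw [← hker]; exact hg
  have hAcom : ∀ a ∈ A, ∀ b ∈ A, ⁅a, b⁆ ∈ Z := by
    intro a ha b hb
    apply hZmem
    rw [map_commutatorElement, commutatorElement_eq_one_iff_mul_comm]
    exact hN.comm ha hb
  have hscA : ∀ a ∈ A, ∀ b ∈ A, ∃ c : K, ρ a * ρ b = c • (ρ b * ρ a) := by
    intro a ha b hb
    obtain ⟨c, hc⟩ := hAcom a ha b hb
    exact ⟨c, scal_of_comm ρ hc⟩
  obtain ⟨x, hx1, hx2⟩ := count (ρ.comp A.subtype) (fun a b => hscA a a.2 b b.2)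
    (Z.subgroupOf A) (by
      intro z
      rw [Subgroup.mem_subgroupOf]
      constructor
      · intro hz a
        exact hZc _ hz _
      · intro hz
        let B : Subgroup G := A ⊓ cen ρ A
        have hB : B.Normal := ⟨by
          rintro b ⟨hb1, hb2⟩ g
          refine ⟨hAn.conj_mem b hb1 g, ?_⟩
          intro y hy
          have h1 := hb2 (g⁻¹ * y * g) (by simpa using hAn.conj_mem y hy g⁻¹)
          have e : ∀ u v : G, Commute (ρ u) (ρ v) ↔ ρ (u * v) = ρ (v * u) := by
            intro u v; rw [map_mul, map_mul]; exact Iff.rfl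
          rw [e] at h1 ⊢
          have h2 := congrArg (fun T => ρ g * T * ρ g⁻¹) h1
          simp only [← map_mul] at h2
          convert h2 using 2 <;> group⟩
        have := hpr B hB (fun a ha b hb => ha.2 b hb.1)
        exact this ⟨z.2, fun y hy => hz ⟨y, hy⟩⟩)
  rw [hn] at hx2
  have hidx : (Z.subgroupOf A).index = Nat.card N := by
    have h1 : Z.relIndex A = Nat.card (A.map π) := by
      have h2 := Subgroup.relIndex_ker A π
      rwa [hker] at h2
    rw [Subgroup.map_comap_eq_self_of_surjective hπ] at h1
    exact h1
  obtain ⟨r, l, hr, hl, hcard, hexp⟩ := hN.exists_prime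
  rw [hidx, hcard] at hx1
  obtain ⟨k, -, hk⟩ := (Nat.dvd_prime_pow hr).mp (Dvd.intro _ hx1.symm)
  have hl2 : l = 2 * k := by
    rw [hk, ← pow_add] at hx1
    have := Nat.pow_right_injective hr.two_le hx1
    omega
  have hk1 : 1 ≤ k := by omega
  -- a noncommuting pair
  obtain ⟨a, ha, b, hb, hab⟩ : ∃ a ∈ A, ∃ b ∈ A, ¬ Commute (ρ a) (ρ b) := by
    by_contra h
    push Not at h
    exact hAZ (hpr A hAn h)
  obtain ⟨c, hc⟩ := hAcom a ha b hb
  have hcab := scal_of_comm ρ hc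
  have hc1 : c ≠ 1 := by
    rintro rfl
    rw [one_smul] at hcab
    exact hab hcab
  have hcr : c ^ r = 1 := by
    have h1 : ∀ i : ℕ, ρ (a ^ i) * ρ b = c ^ i • (ρ b * ρ (a ^ i)) := by
      intro i
      induction i with
      | zero => simp
      | succ i ih =>
        rw [pow_succ, map_mul, mul_assoc, hcab, mul_smul_comm, ← mul_assoc, ih, smul_mul_assoc,
          smul_smul, mul_assoc, pow_succ, mul_comm c]
    have h2 : a ^ r ∈ Z := by
      apply hZmem
      rw [map_pow]
      exact hexp _ ha
    have h3 := h1 r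
    rw [(hZc _ h2 b).eq] at h3
    have h4 : (1 - c ^ r) • ρ (b * a ^ r) = 0 := by
      rw [sub_smul, one_smul, map_mul, ← h3, sub_self]
    have := (smul_eq_zero.mp h4).resolve_right (rep_ne_zero ρ _)
    exact (sub_eq_zero.mp this).symm
  have hrp : r ≠ p := by
    rintro rfl
    have := Fact.mk hr
    have h1 : (c - 1) ^ r = 0 := by
      rw [sub_pow_char, hcr, one_pow, sub_self]
    exact hc1 (sub_eq_zero.mp (pow_eq_zero_iff hr.ne_zero |>.mp h1))
  have hrZ : r ∣ Nat.card Z := by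
    have := Fact.mk hr
    have h1 : orderOf c = r := orderOf_eq_prime hcr hc1
    have h2 : c ^ orderOf (⁅a, b⁆) = 1 := by
      have h3 : ρ (⁅a, b⁆ ^ orderOf ⁅a, b⁆) = 1 := by rw [pow_orderOf_eq_one, map_one]
      rw [map_pow, hc, smul_pow, one_pow] at h3
      have h4 : (c ^ orderOf ⁅a, b⁆ - 1) • (1 : V →ₗ[K] V) = 0 := by
        rw [sub_smul, h3, one_smul, sub_self]
      exact sub_eq_zero.mp ((smul_eq_zero.mp h4).resolve_right one_ne_zero)
    have h5 := orderOf_dvd_of_pow_eq_one h2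
    rw [h1] at h5
    refine h5.trans ?_
    have h6 := orderOf_dvd_natCard (⟨⁅a, b⁆, ⟨c, hc⟩⟩ : Z)
    rwa [← Subgroup.orderOf_coe] at h6
  have hDr : ¬ D ∣ r ^ (2 * k + 1) := by
    intro h
    apply hD
    refine h.trans (dvd_trans ?_ (Subgroup.card_subgroup_dvd_card A))
    have h1 := (Z.subgroupOf A).index_mul_card
    rw [← h1, hidx, hcard, ← hl2, pow_succ]
    apply mul_dvd_mul_left
    rw [Nat.card_congr (Subgroup.subgroupOfEquivOfLe hZA).toEquiv]
    exact hrZ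
  obtain ⟨j, hj, hjm⟩ := hprim r k hr hrp hk1 (hk ▸ hx2) hDr
  have hjc := hj _ N hN (hl2 ▸ hcard)
  have hscD : ∀ d ∈ derivedSeries G j, ∀ a ∈ A, ∃ c : K, ρ d * ρ a = c • (ρ a * ρ d) := by
    intro d hd a ha
    have h1 : ⁅d, a⁆ ∈ Z := by
      apply hZmem
      rw [map_commutatorElement, commutatorElement_eq_one_iff_mul_comm]
      exact (Subgroup.mem_centralizer_iff.mp (hjc (ds_map_le π j hd)) _ ha).symm
    obtain ⟨c, hc⟩ := h1
    exact ⟨c, scal_of_comm ρ hc⟩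
  have hcen : derivedSeries G (j + 1) ≤ cen ρ A := by
    rw [derivedSeries_succ, Subgroup.commutator_le]
    intro d hd d' hd' a ha
    obtain ⟨c, hc⟩ := hscD d hd a ha
    obtain ⟨c', hc'⟩ := hscD d' hd' a ha
    exact comm_of_scal ρ hc hc'
  have hAcen : A ≤ cen ρ A := by
    intro y hy
    obtain ⟨d, hd, hdy⟩ := hND hy
    have h1 : d⁻¹ * y ∈ Z := by
      apply hZmem
      rw [map_mul, map_inv, hdy, inv_mul_cancel]
    have h2 : d ∈ cen ρ A := hcen (derivedSeries_antitone G (by omega) hd)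
    have h3 : d⁻¹ * y ∈ cen ρ A := fun z _ => hZc _ h1 z
    have := mul_mem h2 h3
    simpa using this
  exact hAZ (hpr A hAn (fun a ha b hb => hAcen ha b hb))

theorem lin_one (p D : ℕ) (hp : p.Prime) : LinBd p 1 D 1 := by
  refine lin_step hp le_rfl ?_ ?_
  · intro t d ht hd h; nlinarith
  · intro r k hr _ hk h
    exact absurd h (not_le.mpr (Nat.one_lt_pow (by omega) hr.one_lt))

theorem chief_one (q : ℕ) (hq : q.Prime) : ChiefBd q 1 1 :=
  chief_step hq le_rfl (fun n h1 h2 => by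
    obtain rfl : n = 1 := by omega
    exact lin_one q 0 hq)

/-- small prime powers bookkeeping -/
theorem pp_exp_le {q k B e : ℕ} (hq : q.Prime) (h : q ^ k ≤ B) (hB : B < 2 ^ (e + 1)) : k ≤ e := by
  by_contra hk
  have h1 : 2 ^ (e + 1) ≤ 2 ^ k := Nat.pow_le_pow_right (by norm_num) (by omega)
  have h2 : 2 ^ k ≤ q ^ k := Nat.pow_le_pow_left hq.two_le k
  omega

theorem le_lg {a b : ℕ} (h : 9 ^ a ≤ b) : a ≤ Nat.log 9 b := Nat.le_log_of_pow_le (by norm_num) h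

theorem odd_prime_ge {q : ℕ} (hq : q.Prime) (h2 : q ≠ 2) : 3 ≤ q := by
  have := hq.two_le; omega

theorem perm3 : ∀ t, 1 ≤ t → t ≤ 3 → PermBd t (Nat.log 9 (t ^ 5)) := by
  refine perm_gen 3 ?_
  intro q k hq hk hle
  have hk1 : k ≤ 1 := pp_exp_le hq hle (by norm_num)
  obtain rfl : k = 1 := by omega
  rw [pow_one] at hle ⊢
  by_cases h2 : q = 2
  · subst h2
    exact ⟨0, chief_two_one, le_lg (by norm_num)⟩
  · have := odd_prime_ge hq h2
    obtain rfl : q = 3 := by omega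
    exact ⟨1, chief_one 3 hq, le_lg (by norm_num)⟩

theorem lin_two_two (D : ℕ) : LinBd 2 2 D 2 := by
  refine lin_step Nat.prime_two (by norm_num) ?_ ?_
  · intro t d ht hd h
    obtain rfl : t = 2 := by nlinarith
    obtain rfl : d = 1 := by omega
    exact ⟨_, 1, perm3 2 (by norm_num) (by norm_num), lin_one 2 D Nat.prime_two, by norm_num⟩
  · intro r k hr hr2 hk h
    have h3 := odd_prime_ge hr hr2
    have : r ≤ r ^ k := Nat.le_self_pow (by omega) r
    omega

theorem chief_two_two : ChiefBd 2 2 2 :=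
  chief_step Nat.prime_two (by norm_num) (fun n h1 h2 => by
    interval_cases n
    · exact (lin_one 2 0 Nat.prime_two).mono (by norm_num)
    · exact lin_two_two 0)

theorem perm4 : ∀ t, 1 ≤ t → t ≤ 4 → PermBd t (Nat.log 9 (t ^ 5)) := by
  refine perm_gen 4 ?_
  intro q k hq hk hle
  have hk1 : k ≤ 2 := pp_exp_le hq hle (by norm_num)
  by_cases h2 : q = 2
  · subst h2
    interval_cases k
    · exact ⟨0, chief_two_one, le_lg (by norm_num)⟩
    · exact ⟨2, chief_two_two, le_lg (by norm_num)⟩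
  · have h3 := odd_prime_ge hq h2
    interval_cases k
    · exact ⟨1, chief_one q hq, le_lg ((by norm_num : 9 ^ 2 ≤ (3 ^ 1) ^ 5).trans (by gcongr))⟩
    · nlinarith

theorem imp_mul {p D C n N : ℕ} (hC : C ≠ 0) (hn : n ≤ N)
    (hP : ∀ t, 1 ≤ t → t ≤ N → PermBd t (Nat.log 9 (t ^ 5)))
    (hL : ∀ d, 1 ≤ d → d < n → LinBd p d D (Nat.log 9 (C * d ^ 5))) :
    ∀ t d, 2 ≤ t → 1 ≤ d → t * d ≤ n →
      ∃ m1 m2, PermBd t m1 ∧ LinBd p d D m2 ∧ m1 + m2 ≤ Nat.log 9 (C * n ^ 5) := by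
  intro t d ht hd h
  refine ⟨_, _, hP t (by omega) (by nlinarith), hL d hd (by nlinarith), ?_⟩
  refine (lg_mul _ _ (by positivity) (by positivity)).trans (Nat.log_mono_right ?_)
  calc t ^ 5 * (C * d ^ 5) = C * (t * d) ^ 5 := by ring
    _ ≤ C * n ^ 5 := by gcongr

theorem lin27 : ∀ n, 1 ≤ n → n ≤ 4 → LinBd 2 n 27 (Nat.log 9 (9 * n ^ 5)) := by
  intro n
  induction n using Nat.strong_induction_on with
  | _ n ih =>
    intro h1 h4
    refine lin_step Nat.prime_two ?_ ?_ ?_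
    · refine le_lg ?_
      have : 1 ≤ n ^ 5 := Nat.one_le_pow _ _ h1
      omega
    · exact imp_mul (by norm_num) h4 perm4 (fun d hd hdn => ih d hdn hd (by omega))
    · intro r k hr hr2 hk h hdv
      exfalso
      have h3 := odd_prime_ge hr hr2
      have hk1 : k ≤ 2 := pp_exp_le hr (h.trans h4) (by norm_num)
      interval_cases k
      · have h5 : r ≤ 4 := by simpa using h.trans h4
        interval_cases r
        · exact hdv (by norm_num)
        · exact absurd hr (by norm_num)
      · nlinarith

theorem chief_two_three : ChiefBd 2 3 3 :=
  chief_step27 (Or.inl rfl) (fun n h1 h2 => (lin27 n h1 (by omega)).mono (by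
    interval_cases n <;> norm_num))

theorem chief_two_four : ChiefBd 2 4 4 :=
  chief_step27 (Or.inr rfl) (fun n h1 h2 => (lin27 n h1 (by omega)).mono (by
    interval_cases n <;> norm_num))

theorem lin_p_two (p : ℕ) (hp : p.Prime) : LinBd p 2 0 4 := by
  refine lin_step hp (by norm_num) ?_ ?_
  · intro t d ht hd h
    obtain rfl : t = 2 := by nlinarith
    obtain rfl : d = 1 := by omega
    exact ⟨_, 1, perm3 2 (by norm_num) (by norm_num), lin_one p 0 hp, by norm_num⟩
  · intro r k hr hr2 hk h _
    have : r ≤ r ^ k := Nat.le_self_pow (by omega) r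
    have := hr.two_le
    obtain rfl : r = 2 := by omega
    have hk1 : k ≤ 1 := pp_exp_le hr h (by norm_num)
    obtain rfl : k = 1 := by omega
    exact ⟨2, chief_two_two, by norm_num⟩

theorem chief_q_two (q : ℕ) (hq : q.Prime) : ChiefBd q 2 4 :=
  chief_step hq (by norm_num) (fun n h1 h2 => by
    interval_cases n
    · exact (lin_one q 0 hq).mono (by norm_num)
    · exact lin_p_two q hq)

theorem perm8 : ∀ t, 1 ≤ t → t ≤ 8 → PermBd t (Nat.log 9 (t ^ 5)) := by
  refine perm_gen 8 ?_
  intro q k hq hk hle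
  have hk1 : k ≤ 3 := pp_exp_le hq hle (by norm_num)
  by_cases h2 : q = 2
  · subst h2
    interval_cases k
    · exact ⟨0, chief_two_one, le_lg (by norm_num)⟩
    · exact ⟨2, chief_two_two, le_lg (by norm_num)⟩
    · exact ⟨3, chief_two_three, le_lg (by norm_num)⟩
  · have h3 := odd_prime_ge hq h2
    interval_cases k
    · exact ⟨1, chief_one q hq, le_lg ((by norm_num : 9 ^ 2 ≤ (3 ^ 1) ^ 5).trans (by gcongr))⟩
    · nlinarith
    · have : 3 ^ 3 ≤ q ^ 3 := by gcongr
      omega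

/-- odd primes with prime power at most 8 -/
theorem prim8 {n m : ℕ} (hn : n ≤ 8) (hm : 3 ≤ n → 6 ≤ m) : ∀ r k, r.Prime → r ≠ 2 → 1 ≤ k →
    r ^ k ≤ n → ¬ 0 ∣ r ^ (2 * k + 1) → ∃ j, ChiefBd r (2 * k) j ∧ j + 2 ≤ m := by
  intro r k hr hr2 hk h _
  have h3 := odd_prime_ge hr hr2
  have hk1 : k ≤ 3 := pp_exp_le hr (h.trans hn) (by norm_num)
  interval_cases k
  · exact ⟨4, chief_q_two r hr, hm (by rw [pow_one] at h; omega)⟩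
  · nlinarith
  · have : 3 ^ 3 ≤ r ^ 3 := by gcongr
    omega

theorem lin2_8 : ∀ n, 1 ≤ n → n ≤ 8 → LinBd 2 n 0 (Nat.log 9 (2187 * n ^ 5)) := by
  intro n
  induction n using Nat.strong_induction_on with
  | _ n ih =>
    intro h1 h8
    refine lin_step Nat.prime_two ?_ ?_ ?_
    · refine le_lg ?_
      have : 1 ≤ n ^ 5 := Nat.one_le_pow _ _ h1
      omega
    · exact imp_mul (by norm_num) h8 perm8 (fun d hd hdn => ih d hdn hd (by omega))
    · refine prim8 h8 (fun h3 => le_lg ?_)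
      calc 9 ^ 6 = 2187 * 3 ^ 5 := by norm_num
        _ ≤ 2187 * n ^ 5 := by gcongr

theorem chief_two_six : ChiefBd 2 6 7 :=
  chief_step Nat.prime_two (by norm_num) (fun n h1 h2 => (lin2_8 n h1 (by omega)).mono (by
    interval_cases n <;> norm_num))

theorem chief_two_eight : ChiefBd 2 8 8 :=
  chief_step Nat.prime_two (by norm_num) (fun n h1 h2 => (lin2_8 n h1 (by omega)).mono (by
    interval_cases n <;> norm_num))

theorem lin2_5 : ∀ n, 1 ≤ n → n ≤ 5 → LinBd 2 n 0 6 := by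
  intro n h1 h5
  refine lin_step Nat.prime_two (by norm_num) ?_ (prim8 (by omega) (fun _ => le_rfl))
  intro t d ht hd h
  have hd2 : d ≤ 2 := by nlinarith
  have ht5 : t ≤ 5 := by nlinarith
  refine ⟨3, 2, (perm8 t (by omega) (by omega)).mono ?_, ?_, by norm_num⟩
  · interval_cases t <;> norm_num
  · interval_cases d
    · exact (lin_one 2 0 Nat.prime_two).mono (by norm_num)
    · exact lin_two_two 0

theorem chief_two_five : ChiefBd 2 5 6 :=
  chief_step Nat.prime_two (by norm_num) (fun n h1 h2 => lin2_5 n h1 (by omega))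

theorem pw_bound {b k0 C : ℕ} (hb : 2 ≤ b) (h0 : 1 ≤ k0) (base : C * k0 ^ 5 ≤ (b ^ k0) ^ 5) :
    ∀ k, k0 ≤ k → C * k ^ 5 ≤ (b ^ k) ^ 5 := by
  intro k hk
  induction k, hk using Nat.le_induction with
  | base => exact base
  | succ k hk ih =>
    calc C * (k + 1) ^ 5 ≤ C * (2 * k) ^ 5 := by gcongr; omega
      _ = 2 ^ 5 * (C * k ^ 5) := by ring
      _ ≤ b ^ 5 * (b ^ k) ^ 5 := by gcongr
      _ = (b ^ (k + 1)) ^ 5 := by ring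

theorem lg_add {a b i : ℕ} (ha : a ≠ 0) (h : 9 ^ i * a ≤ b) : Nat.log 9 a + i ≤ Nat.log 9 b := by
  apply le_lg
  rw [pow_add, mul_comm]
  exact (Nat.mul_le_mul_left _ (Nat.pow_log_le_self 9 ha)).trans h

theorem perm_case {n : ℕ}
    (H : ∀ q k : ℕ, q.Prime → 1 ≤ k → k < n → ChiefBd q k (Nat.log 9 (11824 * k ^ 5))) :
    ∀ q k : ℕ, q.Prime → 1 ≤ k → q ^ k ≤ n →
      ∃ j, ChiefBd q k j ∧ j + 1 ≤ Nat.log 9 ((q ^ k) ^ 5) := by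
  intro q k hq hk hle
  have hgen : 9 ^ 1 * 11824 * k ^ 5 ≤ (q ^ k) ^ 5 →
      ∃ j, ChiefBd q k j ∧ j + 1 ≤ Nat.log 9 ((q ^ k) ^ 5) := by
    intro h
    refine ⟨_, H q k hq hk (lt_of_lt_of_le (Nat.lt_pow_self hq.one_lt) hle), ?_⟩
    exact lg_add (by positivity) (by rw [← mul_assoc]; exact h)
  by_cases h2 : q = 2
  · subst h2
    by_cases h6 : 6 ≤ k
    · exact hgen (pw_bound le_rfl (by norm_num) (by norm_num) k h6)
    · interval_cases k
      · exact ⟨0, chief_two_one, le_lg (by norm_num)⟩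
      · exact ⟨2, chief_two_two, le_lg (by norm_num)⟩
      · exact ⟨3, chief_two_three, le_lg (by norm_num)⟩
      · exact ⟨4, chief_two_four, le_lg (by norm_num)⟩
      · exact ⟨6, chief_two_five, le_lg (by norm_num)⟩
  by_cases h3 : q = 3
  · subst h3
    by_cases h6 : 4 ≤ k
    · exact hgen (pw_bound (by norm_num) (by norm_num) (by norm_num) k h6)
    · interval_cases k
      · exact ⟨1, chief_one 3 hq, le_lg (by norm_num)⟩
      · exact ⟨4, chief_q_two 3 hq, le_lg (by norm_num)⟩
      · exact ⟨6, (H 3 3 hq (by norm_num) (by omega)).mono (by norm_num), le_lg (by norm_num)⟩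
  have h5 : 5 ≤ q := by
    have := odd_prime_ge hq h2
    rcases Nat.lt_or_ge q 5 with h | h
    · interval_cases q
      · omega
      · exact absurd hq (by norm_num)
    · exact h
  by_cases h6 : 3 ≤ k
  · refine hgen ((pw_bound (b := 5) (by norm_num) (by norm_num) (by norm_num) k h6).trans ?_)
    gcongr
  · interval_cases k
    · exact ⟨1, chief_one q hq, le_lg ((by norm_num : 9 ^ 2 ≤ (5 ^ 1) ^ 5).trans (by gcongr))⟩
    · exact ⟨4, chief_q_two q hq, le_lg ((by norm_num : 9 ^ 5 ≤ (5 ^ 2) ^ 5).trans (by gcongr))⟩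

theorem prim_case {n : ℕ}
    (H : ∀ q k : ℕ, q.Prime → 1 ≤ k → k < n → ChiefBd q k (Nat.log 9 (11824 * k ^ 5))) :
    ∀ r k : ℕ, r.Prime → 1 ≤ k → r ^ k ≤ n →
      ∃ j, ChiefBd r (2 * k) j ∧ j + 2 ≤ Nat.log 9 (11824 * n ^ 5) := by
  intro r k hr hk hle
  suffices hs : ∃ j, ChiefBd r (2 * k) j ∧ j + 2 ≤ Nat.log 9 (11824 * (r ^ k) ^ 5) by
    obtain ⟨j, h1, h2⟩ := hs
    exact ⟨j, h1, h2.trans (Nat.log_mono_right (by gcongr))⟩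
  have hgen : 2592 * k ^ 5 ≤ (r ^ k) ^ 5 →
      ∃ j, ChiefBd r (2 * k) j ∧ j + 2 ≤ Nat.log 9 (11824 * (r ^ k) ^ 5) := by
    intro h
    have hlt : 2 * k < r ^ k := by
      apply lt_of_pow_lt_pow_left₀ 5 (by positivity)
      refine lt_of_lt_of_le ?_ h
      have : 1 ≤ k ^ 5 := Nat.one_le_pow _ _ hk
      rw [mul_pow]; omega
    refine ⟨_, H r (2 * k) hr (by omega) (by omega), ?_⟩
    apply lg_add (by positivity)
    rw [mul_pow]
    omega
  by_cases h2 : r = 2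
  · subst h2
    by_cases h6 : 5 ≤ k
    · exact hgen (pw_bound le_rfl (by norm_num) (by norm_num) k h6)
    · interval_cases k
      · exact ⟨2, chief_two_two, le_lg (by norm_num)⟩
      · exact ⟨4, chief_two_four, le_lg (by norm_num)⟩
      · exact ⟨7, chief_two_six, le_lg (by norm_num)⟩
      · exact ⟨8, chief_two_eight, le_lg (by norm_num)⟩
  have h3 := odd_prime_ge hr h2
  by_cases h6 : 3 ≤ k
  · refine hgen ((pw_bound (b := 3) (by norm_num) (by norm_num) (by norm_num) k h6).trans ?_)
    gcongr
  · interval_cases k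
    · refine ⟨4, chief_q_two r hr, le_lg ((by norm_num : 9 ^ 6 ≤ 11824 * (3 ^ 1) ^ 5).trans (by gcongr))⟩
    · refine ⟨7, (H r 4 hr (by norm_num) ?_).mono (by norm_num),
        le_lg ((by norm_num : 9 ^ 9 ≤ 11824 * (3 ^ 2) ^ 5).trans (by gcongr))⟩
      nlinarith

theorem chief_of_lin {N : ℕ} (h : ∀ n, 1 ≤ n → n < N → ∀ p : ℕ, p.Prime →
      LinBd p n 0 (Nat.log 9 (11824 * n ^ 5))) :
    ∀ q k : ℕ, q.Prime → 1 ≤ k → k < N → ChiefBd q k (Nat.log 9 (11824 * k ^ 5)) := by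
  intro q k hq hk hkN
  refine chief_step hq hk (fun n h1 h2 => (h n h1 (by omega) q hq).mono ?_)
  exact Nat.log_mono_right (by gcongr)

theorem lin_main : ∀ n, 1 ≤ n → ∀ p : ℕ, p.Prime → LinBd p n 0 (Nat.log 9 (11824 * n ^ 5)) := by
  intro n
  induction n using Nat.strong_induction_on with
  | _ n ih =>
    intro h1 p hp
    have H := chief_of_lin (N := n) (fun k hk1 hk2 => ih k hk2 hk1)
    have hP := perm_gen n (perm_case H)
    refine lin_step hp ?_ ?_ ?_
    · refine le_lg ?_
      have : 1 ≤ n ^ 5 := Nat.one_le_pow _ _ h1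
      omega
    · exact imp_mul (by norm_num) le_rfl hP (fun d hd hdn => ih d hdn hd p hp)
    · intro r k hr _ hk hle _
      exact prim_case H r k hr hk hle

theorem chief_main (q k : ℕ) (hq : q.Prime) (hk : 1 ≤ k) :
    ChiefBd q k (Nat.log 9 (11824 * k ^ 5)) :=
  chief_of_lin (N := k + 1) (fun n h1 _ => lin_main n h1) q k hq hk (by omega)

open ArithmeticFunction in
theorem card_factors_quot {G : Type*} [Group G] [Finite G] (N : Subgroup G) :
    cardFactors (Nat.card G) = cardFactors N.index + cardFactors (Nat.card N) := by
  rw [← N.index_mul_card, cardFactors_mul (Subgroup.index_ne_zero_of_finite) Nat.card_pos.ne']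

open ArithmeticFunction in
theorem chief_series : ∀ (m : ℕ) (G : Type) [Group G] [Finite G] [Group.IsSolvable G],
    Nat.card G = m → ∃ s n : ℕ, 1 ≤ n ∧ n + s ≤ cardFactors (Nat.card G) + 1 ∧
      ∀ j, (∀ p k : ℕ, p.Prime → 1 ≤ k → k ≤ n → ChiefBd p k j) →
        ∃ N : ℕ → Subgroup G, (∀ i, (N i).Normal) ∧ N 0 = ⊥ ∧ (∀ i, s ≤ i → N i = ⊤) ∧
          ∀ i, ⁅derivedSeries G j, N (i + 1)⁆ ≤ N i := by
  intro m
  induction m using Nat.strong_induction_on with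
  | _ m ih =>
  intro G _ _ _ hm
  by_cases htop : (⊤ : Subgroup G) = ⊥
  · refine ⟨0, 1, le_rfl, by omega, fun j _ => ⟨fun _ => ⊥, fun i => inferInstance, rfl,
      fun i _ => htop.symm, fun i => ?_⟩⟩
    exact le_top.trans htop.le
  obtain ⟨N1, hN1, -⟩ := exists_minNormal_le (⊤ : Subgroup G) inferInstance htop
  have hNn : N1.Normal := hN1.1
  obtain ⟨p, k, hp, hk, hcard, -⟩ := hN1.exists_prime
  have hidx : Nat.card (G ⧸ N1) < m := by
    have h1 := N1.index_mul_card
    rw [hm, hcard] at h1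
    have h2 : 1 < p ^ k := Nat.one_lt_pow (by omega) hp.one_lt
    have h3 : 0 < N1.index := Nat.pos_of_ne_zero Subgroup.index_ne_zero_of_finite
    change N1.index < m
    nlinarith
  obtain ⟨s, n, hn, hns, H⟩ := ih _ hidx (G ⧸ N1) rfl
  have hcf : cardFactors (Nat.card G) = cardFactors (Nat.card (G ⧸ N1)) + k := by
    rw [card_factors_quot N1, hcard, cardFactors_apply_prime_pow hp]; rfl
  refine ⟨s + 1, max n k, by omega, by omega, fun j hj => ?_⟩
  obtain ⟨N, a1, a2, a3, a4⟩ := H j (fun p k h1 h2 h3 => hj p k h1 h2 (by omega))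
  refine ⟨fun i => match i with
    | 0 => ⊥
    | i + 1 => (N i).comap (QuotientGroup.mk' N1), ?_, rfl, ?_, ?_⟩
  · rintro (_ | i)
    · change (⊥ : Subgroup G).Normal
      infer_instance
    · exact (a1 i).comap _
  · rintro (_ | i) hi
    · omega
    · change (N i).comap _ = ⊤
      rw [a3 i (by omega), Subgroup.comap_top]
  · rintro (_ | i)
    · change ⁅derivedSeries G j, (N 0).comap (QuotientGroup.mk' N1)⁆ ≤ ⊥
      rw [a2, MonoidHom.comap_bot, QuotientGroup.ker_mk', le_bot_iff,
        Subgroup.commutator_eq_bot_iff_le_centralizer]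
      exact hj p k hp hk (by omega) G N1 hN1 hcard
    · change ⁅derivedSeries G j, (N (i + 1)).comap (QuotientGroup.mk' N1)⁆ ≤
        (N i).comap (QuotientGroup.mk' N1)
      rw [← Subgroup.map_le_iff_le_comap, Subgroup.map_commutator]
      exact (Subgroup.commutator_mono (map_derivedSeries_le_derivedSeries _ _)
        (Subgroup.map_comap_le _ _)).trans (a4 i)

theorem three_sub {G : Type*} [Group G] (A B N : Subgroup G) [hN : N.Normal]
    (h1 : ⁅A, ⁅A, B⁆⁆ ≤ N) : ⁅⁅A, A⁆, B⁆ ≤ N := by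
  have hk : ∀ H : Subgroup G, H ≤ N ↔ H.map (QuotientGroup.mk' N) = ⊥ := by
    intro H
    rw [Subgroup.map_eq_bot_iff, QuotientGroup.ker_mk']
  rw [hk] at h1 ⊢
  simp only [Subgroup.map_commutator] at h1 ⊢
  apply Subgroup.commutator_commutator_eq_bot_of_rotate
  · rw [Subgroup.commutator_comm]; exact h1
  · rw [Subgroup.commutator_comm, Subgroup.commutator_comm (B.map _)]; exact h1

theorem series_comm {G : Type*} [Group G] (N : ℕ → Subgroup G) (hN : ∀ i, (N i).Normal) (j : ℕ)
    (h : ∀ i, ⁅derivedSeries G j, N (i + 1)⁆ ≤ N i) (e : ℕ) :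
    ∀ i, ⁅derivedSeries G (j + e), N (i + 2 ^ e)⁆ ≤ N i := by
  induction e with
  | zero => simpa using h
  | succ e ih =>
    intro i
    have := hN i
    rw [← add_assoc, derivedSeries_succ]
    apply three_sub
    refine le_trans (Subgroup.commutator_mono le_rfl ?_) (ih i)
    rw [pow_succ, mul_two, ← add_assoc]
    exact ih _

theorem series_ds {G : Type*} [Group G] (N : ℕ → Subgroup G) (hN : ∀ i, (N i).Normal) (j s : ℕ)
    (hs : ∀ i, s ≤ i → N i = ⊤)
    (h : ∀ i, ⁅derivedSeries G j, N (i + 1)⁆ ≤ N i) (e : ℕ) :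
    ∀ i, s + 1 ≤ i + 2 ^ e → derivedSeries G (j + e) ≤ N i := by
  induction e with
  | zero => intro i hi; rw [hs i (by simpa using hi)]; exact le_top
  | succ e ih =>
    intro i hi
    rw [← add_assoc, derivedSeries_succ]
    refine (Subgroup.commutator_mono le_rfl (ih (i + 2 ^ e) ?_)).trans (series_comm N hN j h e i)
    rw [pow_succ] at hi; omega

theorem ub_chief {G : Type} [Group G] [Finite G] [Group.IsSolvable G] (d : ℕ) (hd : 1 ≤ d)
    (hdl : DerivedLengthEq G d) : ∃ s n : ℕ, 1 ≤ n ∧ 1 ≤ s ∧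
    n + s ≤ Omega (Nat.card G) + 1 ∧ d ≤ Nat.log 9 (11824 * n ^ 5) + Nat.size s := by
  obtain ⟨s, n, hn, hns, H⟩ := chief_series _ G rfl
  obtain ⟨N, a1, a2, a3, a4⟩ := H (Nat.log 9 (11824 * n ^ 5)) (fun p k h1 h2 h3 =>
    (chief_main p k h1 h2).mono (Nat.log_mono_right (by gcongr)))
  refine ⟨s, n, hn, ?_, hns, ?_⟩
  · by_contra hs
    have h0 := a3 0 (by omega)
    have := hdl.2 0 (by omega)
    rw [a2] at h0
    exact this (by rw [derivedSeries_zero, h0])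
  · have h1 := series_ds N a1 _ s a3 a4 (Nat.size s) 0 (by have := Nat.lt_size_self s; omega)
    rw [a2, le_bot_iff] at h1
    by_contra hlt
    exact hdl.2 _ (by omega) h1

open ArithmeticFunction in
theorem ub_omega {G : Type} [Group G] [Finite G] [Group.IsSolvable G] (k : ℕ) :
    derivedSeries G k = ⊥ ∨
    cardFactors (Nat.card (derivedSeries G k)) + k ≤ cardFactors (Nat.card G) := by
  induction k with
  | zero => right; simp
  | succ k ih =>
    rcases ih with h | h
    · left; rw [derivedSeries_succ, h]; simp
    by_cases h0 : derivedSeries G k = ⊥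
    · left; rw [derivedSeries_succ, h0]; simp
    right
    have hlt : derivedSeries G (k + 1) < derivedSeries G k :=
      Group.IsSolvable.commutator_lt_of_ne_bot h0
    obtain ⟨m, hm⟩ := Subgroup.card_dvd_of_le hlt.le
    have hpos : 0 < Nat.card (derivedSeries G k) := Nat.card_pos
    have hm0 : m ≠ 0 := by rintro rfl; omega
    have hm1 : m ≠ 1 := by
      rintro rfl
      exact hlt.ne (Subgroup.eq_of_le_of_card_ge hlt.le (by omega))
    have h3 : cardFactors m ≠ 0 := by
      rw [Ne, cardFactors_eq_zero_iff_eq_zero_or_one]; tauto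
    rw [hm, cardFactors_mul Nat.card_pos.ne' hm0] at h
    omega

theorem ub_dl {G : Type} [Group G] [Finite G] [Group.IsSolvable G] (d : ℕ)
    (hdl : DerivedLengthEq G d) : d ≤ Omega (Nat.card G) := by
  by_contra hlt
  rcases d with _ | d
  · omega
  rcases ub_omega (G := G) d with h | h
  · exact hdl.2 d (by omega) h
  have h2 : ArithmeticFunction.cardFactors (Nat.card (derivedSeries G d)) = 0 := by
    change ¬ (d + 1 ≤ ArithmeticFunction.cardFactors (Nat.card G)) at hlt
    omega
  rw [ArithmeticFunction.cardFactors_eq_zero_iff_eq_zero_or_one] at h2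
  have hpos : 0 < Nat.card (derivedSeries G d) := Nat.card_pos
  exact hdl.2 d (by omega) (Subgroup.card_eq_one.mp (by omega))

set_option exponentiation.threshold 2000

theorem amgm32 {n s T : ℝ} (hn : 0 ≤ n) (hs : 0 ≤ s) (h : n + s ≤ T) :
    3125 * (n ^ 3 * s ^ 2) ≤ 108 * T ^ 5 := by
  have h1 : (n + s) ^ 5 ≤ T ^ 5 := by gcongr
  have h2 : 0 ≤ (2 * n - 3 * s) ^ 2 * (27 * n ^ 3 + 216 * n ^ 2 * s + 76 * n * s ^ 2 + 12 * s ^ 3) :=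
    by positivity
  nlinarith

theorem gam_ge {a b : ℕ} (hb : 0 < b) (h : 9 ^ a ≤ 2 ^ b) : (a / b : ℝ) ≤ Real.logb 9 2 := by
  rw [Real.le_logb_iff_rpow_le (by norm_num) (by norm_num)]
  have hb' : (0 : ℝ) < b := by exact_mod_cast hb
  rw [← Real.rpow_le_rpow_iff (z := b) (by positivity) (by norm_num) hb', ← Real.rpow_mul (by norm_num),
    div_mul_cancel₀ _ hb'.ne', Real.rpow_natCast, Real.rpow_natCast]
  exact_mod_cast h

theorem ub_large (d c s n : ℕ) (hc : 23 ≤ c) (hn : 1 ≤ n) (hs : 1 ≤ s) (hns : n + s ≤ c + 1)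
    (hd : d ≤ Nat.log 9 (11824 * n ^ 5) + Nat.size s) :
    (d : ℝ) < (5 * Real.logb 9 2 + 1) * Real.logb 2 c + 3 := by
  have hg : (0.3 : ℝ) ≤ Real.logb 9 2 := by
    have := gam_ge (a := 3) (b := 10) (by norm_num) (by norm_num)
    norm_num at this ⊢; exact this
  have hnR : (0 : ℝ) < n := by exact_mod_cast hn
  have hsR : (0 : ℝ) < s := by exact_mod_cast hs
  have hcR : (23 : ℝ) ≤ c := by exact_mod_cast hc
  have hnsR : (n : ℝ) + s ≤ c + 1 := by exact_mod_cast hns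
  have hxL : Real.logb 2 n ≤ Real.logb 2 c :=
    Real.logb_le_logb_of_le (by norm_num) hnR (by exact_mod_cast (by omega : n ≤ c))
  -- size part
  have he : ((Nat.size s : ℕ) : ℝ) ≤ 1 + Real.logb 2 s := by
    have h1 : 2 ^ (Nat.size s - 1) ≤ s := by
      have h0 : 0 < Nat.size s := Nat.size_pos.mpr hs
      exact Nat.lt_size.mp (by omega)
    have h0 : 0 < Nat.size s := Nat.size_pos.mpr hs
    have h2 : (((Nat.size s - 1 : ℕ)) : ℝ) ≤ Real.logb 2 s := by
      rw [Real.le_logb_iff_rpow_le (by norm_num) hsR, Real.rpow_natCast]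
      exact_mod_cast h1
    rw [Nat.cast_sub (by omega)] at h2
    push_cast at h2; linarith
  have ha : ((Nat.log 9 (11824 * n ^ 5) : ℕ) : ℝ) ≤ 4.27 + 5 * Real.logb 9 2 * Real.logb 2 n := by
    have h1 : 9 ^ (Nat.log 9 (11824 * n ^ 5)) ≤ 11824 * n ^ 5 := Nat.pow_log_le_self _ (by positivity)
    have h2 : ((Nat.log 9 (11824 * n ^ 5) : ℕ) : ℝ) ≤ Real.logb 9 (11824 * n ^ 5) := by
      rw [Real.le_logb_iff_rpow_le (by norm_num) (by positivity), Real.rpow_natCast]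
      exact_mod_cast h1
    rw [Real.logb_mul (by norm_num) (by positivity), Real.logb_pow,
      ← Real.mul_logb (a := 9) (b := 2) (c := n) (by norm_num) (by norm_num) (by norm_num)] at h2
    have h3 : Real.logb 9 11824 ≤ 4.27 := by
      rw [Real.logb_le_iff_le_rpow (by norm_num) (by norm_num),
        ← Real.rpow_le_rpow_iff (z := 100) (by positivity) (by positivity) (by norm_num),
        ← Real.rpow_mul (by norm_num)]
      norm_num
    push_cast at h2
    linarith
  have hkey : 3 * Real.logb 2 n + 2 * Real.logb 2 s + 4.54 < 5 * Real.logb 2 c := by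
    have h1 := amgm32 hnR.le hsR.le hnsR
    have h2 : ((c : ℝ) + 1) ^ 5 ≤ (24 / 23 * c) ^ 5 := by gcongr; linarith
    have hc5 : (0 : ℝ) < (c : ℝ) ^ 5 := by positivity
    have h3 : (23.27 : ℝ) * ((n : ℝ) ^ 3 * s ^ 2) < (c : ℝ) ^ 5 := by
      rw [mul_pow] at h2
      norm_num at h2 ⊢
      nlinarith
    have h4 := Real.logb_lt_logb (b := 2) (by norm_num) (by positivity) h3
    rw [Real.logb_mul (by norm_num) (by positivity), Real.logb_mul (by positivity) (by positivity),
      Real.logb_pow, Real.logb_pow, Real.logb_pow] at h4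
    have h5 : 4.54 ≤ Real.logb 2 23.27 := by
      rw [Real.le_logb_iff_rpow_le (by norm_num) (by norm_num),
        ← Real.rpow_le_rpow_iff (z := 100) (by positivity) (by positivity) (by norm_num),
        ← Real.rpow_mul (by norm_num)]
      norm_num
    push_cast at h4
    linarith
  have hdR : (d : ℝ) ≤ (Nat.log 9 (11824 * n ^ 5) : ℕ) + (Nat.size s : ℕ) := by exact_mod_cast hd
  nlinarith [mul_nonneg (sub_nonneg.mpr hg) (sub_nonneg.mpr hxL)]

theorem ub_crit (d c : ℕ) (hc : 1 ≤ c) (h : 2 ^ (100 * d) < 2 ^ 300 * c ^ 257) :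
    (d : ℝ) < (5 * Real.logb 9 2 + 1) * Real.logb 2 c + 3 := by
  have hg : (0.314 : ℝ) ≤ Real.logb 9 2 := by
    have := gam_ge (a := 314) (b := 1000) (by norm_num) (by norm_num)
    norm_num at this ⊢; exact this
  have hcR : (1 : ℝ) ≤ c := by exact_mod_cast hc
  have hL : 0 ≤ Real.logb 2 c := Real.logb_nonneg (by norm_num) hcR
  have h' : (2 : ℝ) ^ (100 * d) < 2 ^ 300 * (c : ℝ) ^ 257 := by exact_mod_cast h
  have h4 := Real.logb_lt_logb (b := 2) (by norm_num) (by positivity) h'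
  rw [Real.logb_mul (by positivity) (by positivity), Real.logb_pow, Real.logb_pow, Real.logb_pow,
    Real.logb_self_eq_one (by norm_num)] at h4
  push_cast at h4
  nlinarith

theorem ub_table : ∀ c < 23, 13 ≤ c → ∀ n < 23, 1 ≤ n → n ≤ c →
    2 ^ (100 * (Nat.log 9 (11824 * n ^ 5) + Nat.size (c + 1 - n))) < 2 ^ 300 * c ^ 257 := by
  decide +kernel

theorem ub_final (d c s n : ℕ) (hd1 : 1 ≤ d) (hdc : d ≤ c) (hn : 1 ≤ n) (hs : 1 ≤ s)
    (hns : n + s ≤ c + 1) (hd : d ≤ Nat.log 9 (11824 * n ^ 5) + Nat.size s) :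
    (d : ℝ) < (5 * Real.logb 9 2 + 1) * Real.logb 2 c + 3 := by
  rcases le_or_gt 23 c with h | h
  · exact ub_large d c s n h hn hs hns hd
  apply ub_crit d c (by omega)
  rcases le_or_gt 13 c with h13 | h13
  · refine lt_of_le_of_lt ?_ (ub_table c h h13 n (by omega) hn (by omega))
    apply Nat.pow_le_pow_right (by norm_num)
    have := Nat.size_le_size (show s ≤ c + 1 - n by omega)
    omega
  · refine lt_of_le_of_lt (Nat.pow_le_pow_right (by norm_num) (Nat.mul_le_mul_left 100 hdc)) ?_
    have hc1 : 1 ≤ c := by omega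
    interval_cases c <;> norm_num

open scoped commutatorElement MatrixGroups

abbrev GLt := Matrix.GeneralLinearGroup (Fin 2) (ZMod 3)

def mkGL (a b c d a' b' c' d' : ZMod 3)
    (h : !![a, b; c, d] * !![a', b'; c', d'] = (1 : Matrix (Fin 2) (Fin 2) (ZMod 3)))
    (h' : !![a', b'; c', d'] * !![a, b; c, d] = (1 : Matrix (Fin 2) (Fin 2) (ZMod 3))) : GLt :=
  ⟨!![a, b; c, d], !![a', b'; c', d'], h, h'⟩

theorem ds_comm {G : Type*} [Group G] {n : ℕ} {x g h : G} (hg : g ∈ derivedSeries G n)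
    (hh : h ∈ derivedSeries G n) (e : x = g * h * g⁻¹ * h⁻¹) : x ∈ derivedSeries G (n + 1) := by
  rw [e, derivedSeries_succ]
  exact Subgroup.commutator_mem_commutator hg hh

def gl_w : GLt := mkGL 0 1 1 0 0 1 1 0 (by decide) (by decide)
def gl_p : GLt := mkGL 1 2 1 1 2 2 1 2 (by decide) (by decide)
def gl_q : GLt := mkGL 0 1 1 1 2 1 1 0 (by decide) (by decide)
def gl_r : GLt := mkGL 0 1 2 2 2 2 1 0 (by decide) (by decide)
def gl_a : GLt := mkGL 0 1 2 0 0 2 1 0 (by decide) (by decide)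
def gl_b : GLt := mkGL 0 1 2 1 1 2 1 0 (by decide) (by decide)
def gl_i : GLt := mkGL 2 2 2 1 1 1 1 2 (by decide) (by decide)
def gl_j : GLt := mkGL 2 1 1 1 1 2 2 2 (by decide) (by decide)
def gl_z : GLt := mkGL 2 0 0 2 2 0 0 2 (by decide) (by decide)

theorem gl_z_mem : gl_z ∈ derivedSeries GLt 3 := by
  have ha : gl_a ∈ derivedSeries GLt 1 :=
    ds_comm (g := gl_w) (h := gl_p) trivial trivial (Units.ext (by decide))
  have hb : gl_b ∈ derivedSeries GLt 1 :=
    ds_comm (g := gl_w) (h := gl_q) trivial trivial (Units.ext (by decide))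
  have hr : gl_r ∈ derivedSeries GLt 1 :=
    ds_comm (g := gl_w) (h := gl_r) trivial trivial (Units.ext (by decide))
  have hi : gl_i ∈ derivedSeries GLt 2 := ds_comm ha hb (Units.ext (by decide))
  have hj : gl_j ∈ derivedSeries GLt 2 := ds_comm ha hr (Units.ext (by decide))
  exact ds_comm hi hj (Units.ext (by decide))

theorem gl_z_ne : gl_z ≠ 1 := by
  intro h
  have := congrArg Units.val h
  revert this
  decide

theorem gl_card : Nat.card GLt = 48 := by
  rw [Matrix.card_GL_field]
  simp [Fin.prod_univ_two, ZMod.card]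

def IsQ (a b c d : ZMod 3) : Prop := a * d - b * c = 1 ∧ (a + d = 0 ∨ (b = 0 ∧ c = 0))

instance (a b c d : ZMod 3) : Decidable (IsQ a b c d) := by unfold IsQ; infer_instance

theorem isQ_mul : ∀ a b c d : ZMod 3, IsQ a b c d → ∀ e f g h : ZMod 3, IsQ e f g h →
    IsQ (a * e + b * g) (a * f + b * h) (c * e + d * g) (c * f + d * h) := by
  decide +kernel

theorem isQ_inv : ∀ a b c d : ZMod 3, IsQ a b c d → IsQ d (-b) (-c) a := by
  decide +kernel

/-- explicit product `g h g⁻¹ h⁻¹` for matrices of determinant one -/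
def cmm (a b c d e f g h : ZMod 3) : Matrix (Fin 2) (Fin 2) (ZMod 3) :=
  !![(a * e + b * g) * (d * h + b * g) + (a * f + b * h) * (-c * h - a * g),
     (a * e + b * g) * (-d * f - b * e) + (a * f + b * h) * (c * f + a * e);
     (c * e + d * g) * (d * h + b * g) + (c * f + d * h) * (-c * h - a * g),
     (c * e + d * g) * (-d * f - b * e) + (c * f + d * h) * (c * f + a * e)]

theorem isQ_cmm : ∀ a b c d : ZMod 3, a * d - b * c = 1 → ∀ e f g h : ZMod 3, e * h - f * g = 1 →
    IsQ (cmm a b c d e f g h 0 0) (cmm a b c d e f g h 0 1) (cmm a b c d e f g h 1 0)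
      (cmm a b c d e f g h 1 1) := by
  decide +kernel

theorem z_cmm : ∀ a b c d : ZMod 3, IsQ a b c d → ∀ e f g h : ZMod 3, IsQ e f g h →
    cmm a b c d e f g h 0 1 = 0 ∧ cmm a b c d e f g h 1 0 = 0 ∧
      cmm a b c d e f g h 0 0 = cmm a b c d e f g h 1 1 := by
  decide +kernel

theorem gl_inv (g : GLt) (hg : g.1 0 0 * g.1 1 1 - g.1 0 1 * g.1 1 0 = 1) :
    (g⁻¹).1 = !![g.1 1 1, - g.1 0 1; - g.1 1 0, g.1 0 0] := by
  rw [Matrix.coe_units_inv, Matrix.inv_def, Matrix.det_fin_two, hg, Ring.inverse_one, one_smul,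
    Matrix.adjugate_fin_two]

theorem gl_comm (g h : GLt) (hg : g.1 0 0 * g.1 1 1 - g.1 0 1 * g.1 1 0 = 1)
    (hh : h.1 0 0 * h.1 1 1 - h.1 0 1 * h.1 1 0 = 1) :
    (⁅g, h⁆).1 = cmm (g.1 0 0) (g.1 0 1) (g.1 1 0) (g.1 1 1) (h.1 0 0) (h.1 0 1) (h.1 1 0)
      (h.1 1 1) := by
  rw [commutatorElement_def, Units.val_mul, Units.val_mul, Units.val_mul, gl_inv g hg, gl_inv h hh]
  conv_lhs => rw [Matrix.eta_fin_two g.1, Matrix.eta_fin_two h.1]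
  simp only [Matrix.mul_fin_two, cmm]
  ext i j
  fin_cases i <;> fin_cases j <;> simp <;> ring

def qSub : Subgroup GLt where
  carrier := {g | IsQ (g.1 0 0) (g.1 0 1) (g.1 1 0) (g.1 1 1)}
  mul_mem' := by
    intro g h hg hh
    have := isQ_mul _ _ _ _ hg _ _ _ _ hh
    simpa [Matrix.mul_apply, Fin.sum_univ_two] using this
  one_mem' := by
    change IsQ _ _ _ _
    decide
  inv_mem' := by
    intro g hg
    change IsQ _ _ _ _
    rw [gl_inv g hg.1]
    exact isQ_inv _ _ _ _ hg

theorem gl_ds1 : derivedSeries GLt 1 ≤ (Matrix.GeneralLinearGroup.det (n := Fin 2) (R := ZMod 3)).ker := by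
  rw [derivedSeries_one]
  exact Abelianization.commutator_subset_ker _

theorem gl_det {g : GLt} (hg : g ∈ (Matrix.GeneralLinearGroup.det (n := Fin 2) (R := ZMod 3)).ker) :
    g.1 0 0 * g.1 1 1 - g.1 0 1 * g.1 1 0 = 1 := by
  rw [MonoidHom.mem_ker] at hg
  have := congrArg Units.val hg
  rw [Matrix.GeneralLinearGroup.val_det_apply, Matrix.det_fin_two] at this
  exact this

theorem gl_ds2 : derivedSeries GLt 2 ≤ qSub := by
  rw [derivedSeries_succ, Subgroup.commutator_le]
  intro g hg h hh
  have h1 := gl_det (gl_ds1 hg)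
  have h2 := gl_det (gl_ds1 hh)
  change IsQ _ _ _ _
  rw [gl_comm g h h1 h2]
  exact isQ_cmm _ _ _ _ h1 _ _ _ _ h2

theorem gl_ds3 : derivedSeries GLt 3 ≤ Subgroup.center GLt := by
  rw [derivedSeries_succ, Subgroup.commutator_le]
  intro g hg h hh
  have h1 := gl_ds2 hg
  have h2 := gl_ds2 hh
  obtain ⟨e1, e2, e3⟩ := z_cmm _ _ _ _ h1 _ _ _ _ h2
  rw [Subgroup.mem_center_iff]
  intro k
  apply Units.ext
  rw [Units.val_mul, Units.val_mul]
  have e4 : (⁅g, h⁆).1 = (cmm (g.1 0 0) (g.1 0 1) (g.1 1 0) (g.1 1 1) (h.1 0 0) (h.1 0 1) (h.1 1 0)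
      (h.1 1 1) 1 1) • (1 : Matrix (Fin 2) (Fin 2) (ZMod 3)) := by
    rw [gl_comm g h h1.1 h2.1]
    ext i j
    fin_cases i <;> fin_cases j <;> simp [e1, e2, e3]
  rw [e4]
  simp

theorem gl_solv : Group.IsSolvable GLt := by
  refine ⟨4, ?_⟩
  rw [derivedSeries_succ, Subgroup.commutator_eq_bot_iff_le_centralizer]
  refine gl_ds3.trans (Subgroup.center_le_centralizer _)

open scoped commutatorElement

abbrev Vt := Fin 2 → ZMod 3

def glAut : GLt →* MulAut (Multiplicative Vt) where
  toFun g :=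
    { toFun := fun v => Multiplicative.ofAdd (g.1.mulVec v.toAdd)
      invFun := fun v => Multiplicative.ofAdd ((g⁻¹).1.mulVec v.toAdd)
      left_inv := fun v => by
        simp only [toAdd_ofAdd, Matrix.mulVec_mulVec, ← Units.val_mul]
        simp
      right_inv := fun v => by
        simp only [toAdd_ofAdd, Matrix.mulVec_mulVec, ← Units.val_mul]
        simp
      map_mul' := fun v w => by
        simp only [toAdd_mul, Matrix.mulVec_add, ofAdd_add] }
  map_one' := by
    ext v : 1
    simp
  map_mul' g h := by
    ext v : 1
    change Multiplicative.ofAdd ((g.1 * h.1).mulVec v.toAdd) =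
      Multiplicative.ofAdd (g.1.mulVec (h.1.mulVec v.toAdd))
    rw [Matrix.mulVec_mulVec]

theorem glAut_apply (g : GLt) (v : Multiplicative Vt) :
    glAut g v = Multiplicative.ofAdd (g.1.mulVec v.toAdd) := rfl

abbrev AGLt := Multiplicative Vt ⋊[glAut] GLt

instance aglAct : MulAction AGLt Vt where
  smul b x := b.left.toAdd + b.right.1.mulVec x
  one_smul x := by
    change (1 : AGLt).left.toAdd + (1 : AGLt).right.1.mulVec x = x
    simp
  mul_smul b c x := by
    change (b * c).left.toAdd + (b * c).right.1.mulVec x =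
      b.left.toAdd + b.right.1.mulVec (c.left.toAdd + c.right.1.mulVec x)
    rw [Matrix.mulVec_add, Matrix.mulVec_mulVec, SemidirectProduct.mul_left,
      SemidirectProduct.mul_right, toAdd_mul, glAut_apply, toAdd_ofAdd, Units.val_mul, add_assoc]

theorem agl_smul (b : AGLt) (x : Vt) : b • x = b.left.toAdd + b.right.1.mulVec x := rfl

theorem sdp_solv {N G : Type*} [Group N] [Group G] (φ : G →* MulAut N) (hN : Group.IsSolvable N)
    (hG : Group.IsSolvable G) : Group.IsSolvable (N ⋊[φ] G) :=
  Group.isSolvable_of_ker_le_range SemidirectProduct.inl SemidirectProduct.rightHom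
    (SemidirectProduct.range_inl_eq_ker_rightHom).ge

theorem agl_solv : Group.IsSolvable AGLt := sdp_solv _ inferInstance gl_solv

theorem agl_card : Nat.card AGLt = 432 := by
  rw [SemidirectProduct.card, gl_card]
  simp

def agl_z : AGLt := SemidirectProduct.inr gl_z
def agl_v (v : Vt) : AGLt := SemidirectProduct.inl (Multiplicative.ofAdd v)

theorem agl_z_smul (x : Vt) : agl_z • x = -x := by
  rw [agl_smul]
  revert x
  decide

theorem agl_v_smul (v x : Vt) : agl_v v • x = v + x := by
  simp [agl_smul, agl_v]

theorem agl_z_mem : agl_z ∈ derivedSeries AGLt 3 := ds_map_le _ 3 gl_z_mem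

theorem glAut_z (v : Vt) : glAut gl_z (Multiplicative.ofAdd v) = Multiplicative.ofAdd (-v) := by
  rw [glAut_apply]
  congr 1
  revert v
  decide

theorem agl_v_mem (k : ℕ) (hk : k ≤ 4) (v : Vt) : agl_v v ∈ derivedSeries AGLt k := by
  induction k generalizing v with
  | zero => trivial
  | succ k ih =>
    have h1 : agl_z ∈ derivedSeries AGLt k := derivedSeries_antitone _ (by omega) agl_z_mem
    refine ds_comm (ih (by omega) (-v)) h1 ?_
    have h2 : agl_z * (agl_v (-v))⁻¹ * agl_z⁻¹ = agl_v (-v) := by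
      have h3 := SemidirectProduct.inl_aut (φ := glAut) gl_z (Multiplicative.ofAdd v)
      rw [glAut_z] at h3
      have h4 : (agl_v (-v))⁻¹ = agl_v v := by
        simp only [agl_v, ← map_inv, ← ofAdd_neg, neg_neg]
      rw [h4]
      simp only [agl_v, agl_z, h3, map_inv]
    have h5 : agl_v v = agl_v (-v) * agl_v (-v) := by
      simp only [agl_v, ← map_mul, ← ofAdd_add]
      congr 2
      clear h2
      revert v
      decide
    rw [h5]
    conv_lhs => rw [← h2]
    rw [h2]
    simp only [mul_assoc] at h2 ⊢
    rw [h2]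

abbrev Wr (A : Type) [Group A] := (Vt → A) ⋊[mulAutArrow] AGLt

section wreath

variable {A : Type} [Group A]

theorem wr_step (b : AGLt) (k : ℕ) (hb : b ∈ derivedSeries AGLt k) (a : A) (m : Vt → ℤ)
    (hm : (SemidirectProduct.inl (fun x => a ^ m x) : Wr A) ∈ derivedSeries (Wr A) k) :
    (SemidirectProduct.inl (fun x => a ^ (m (b⁻¹ • x) - m x)) : Wr A) ∈
      derivedSeries (Wr A) (k + 1) := by
  refine ds_comm (ds_map_le (SemidirectProduct.inr : AGLt →* Wr A) k hb) hm ?_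
  rw [← map_inv SemidirectProduct.inr, ← SemidirectProduct.inl_aut, ← map_inv, ← map_mul]
  congr 1
  ext x
  rw [zpow_sub]
  rfl

theorem wr_z (k : ℕ) (hk : k ≤ 3) (a : A) (m : Vt → ℤ)
    (hm : (SemidirectProduct.inl (fun x => a ^ m x) : Wr A) ∈ derivedSeries (Wr A) k) :
    (SemidirectProduct.inl (fun x => a ^ (m (-x) - m x)) : Wr A) ∈ derivedSeries (Wr A) (k + 1) := by
  have h := wr_step agl_z k (derivedSeries_antitone _ hk agl_z_mem) a m hm
  have e : ∀ x : Vt, agl_z⁻¹ • x = -x := fun x => by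
    rw [inv_smul_eq_iff, agl_z_smul, neg_neg]
  simpa only [e] using h

theorem wr_v (v : Vt) (k : ℕ) (hk : k ≤ 4) (a : A) (m : Vt → ℤ)
    (hm : (SemidirectProduct.inl (fun x => a ^ m x) : Wr A) ∈ derivedSeries (Wr A) k) :
    (SemidirectProduct.inl (fun x => a ^ (m (-v + x) - m x)) : Wr A) ∈
      derivedSeries (Wr A) (k + 1) := by
  have h := wr_step (agl_v v) k (agl_v_mem k hk v) a m hm
  have e : ∀ x : Vt, (agl_v v)⁻¹ • x = -v + x := fun x => by
    rw [inv_smul_eq_iff, agl_v_smul, add_neg_cancel_left]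
  simpa only [e] using h

theorem wr_base (a : A) :
    ∃ f : Vt → A, f 0 = a ∧ (SemidirectProduct.inl f : Wr A) ∈ derivedSeries (Wr A) 5 := by
  have h1 := wr_v ![1, 0] 4 le_rfl a _ (wr_z 3 (by omega) a _ (wr_z 2 (by omega) a _ (wr_z 1 (by omega) a _
    (wr_z 0 (by omega) a (fun x => if x = (![1, 0] : Vt) then 1 else 0) trivial))))
  have h2 := wr_v ![1, 0] 4 (by omega) a _ (wr_v ![1, 0] 3 (by omega) a _ (wr_v ![1, 0] 2 (by omega) a _
    (wr_v ![1, 0] 1 (by omega) a _ (wr_v ![1, 0] 0 (by omega) a (fun x => if x = 0 then 1 else 0) trivial))))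
  refine ⟨_, ?_, by have h3 := mul_mem h1 h2; rw [← map_mul] at h3; exact h3⟩
  rw [Pi.mul_apply, ← zpow_add]
  conv_rhs => rw [← zpow_one a]
  congr 1

theorem wr_ds (k : ℕ) : derivedSeries A k ≤
    ((derivedSeries (Wr A) (5 + k)).comap SemidirectProduct.inl).map
      (Pi.evalMonoidHom (fun _ : Vt => A) 0) := by
  induction k with
  | zero =>
    intro a _
    obtain ⟨f, h1, h2⟩ := wr_base a
    exact ⟨f, h2, h1⟩
  | succ k ih =>
    rw [derivedSeries_succ]
    refine (Subgroup.commutator_mono ih ih).trans ?_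
    rw [← Subgroup.map_commutator]
    apply Subgroup.map_mono
    rw [← add_assoc, derivedSeries_succ, ← Subgroup.map_le_iff_le_comap, Subgroup.map_commutator]
    exact Subgroup.commutator_mono (Subgroup.map_comap_le _ _) (Subgroup.map_comap_le _ _)

theorem pi_solv (X : Type) (hA : Group.IsSolvable A) : Group.IsSolvable (X → A) := by
  obtain ⟨n, hn⟩ := hA
  refine ⟨n, ?_⟩
  rw [eq_bot_iff]
  intro f hf
  rw [Subgroup.mem_bot]
  ext x
  have := ds_map_le (Pi.evalMonoidHom (fun _ : X => A) x) n hf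
  rw [hn] at this
  exact this

end wreath

def HasDL (r w : ℕ) : Prop := ∃ (G : Type) (_ : Group G) (_ : Finite G), Group.IsSolvable G ∧
  (∀ k < r, derivedSeries G k ≠ ⊥) ∧ ArithmeticFunction.cardFactors (Nat.card G) ≤ w

theorem cf_432 : ArithmeticFunction.cardFactors 432 = 7 := by
  rw [show 432 = 2 ^ 4 * 3 ^ 3 by norm_num, ArithmeticFunction.cardFactors_mul (by norm_num) (by norm_num),
    ArithmeticFunction.cardFactors_apply_prime_pow Nat.prime_two,
    ArithmeticFunction.cardFactors_apply_prime_pow Nat.prime_three]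

theorem HasDL.step {r w : ℕ} (h : HasDL r w) : HasDL (r + 5) (9 * w + 7) := by
  obtain ⟨A, _, _, h1, h2, h3⟩ := h
  have : Finite AGLt := Finite.of_equiv _ SemidirectProduct.equivProd.symm
  have : Finite (Wr A) := Finite.of_equiv _ SemidirectProduct.equivProd.symm
  refine ⟨Wr A, inferInstance, this, sdp_solv _ (pi_solv _ h1) agl_solv, ?_, ?_⟩
  · intro k hk hbot
    rcases lt_or_ge k 5 with h5 | h5
    · have h6 := ds_map_le (SemidirectProduct.inr : AGLt →* Wr A) k
        (agl_v_mem k (by omega) ![1, 0])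
      rw [hbot, Subgroup.mem_bot, ← map_one (SemidirectProduct.inr : AGLt →* Wr A)] at h6
      have h7 := SemidirectProduct.inr_injective h6
      have h8 := congrArg (fun b : AGLt => b • (0 : Vt)) h7
      simp only [agl_v_smul, one_smul] at h8
      revert h8
      decide
    · obtain ⟨k, rfl⟩ := Nat.exists_eq_add_of_le h5
      apply h2 k (by omega)
      rw [eq_bot_iff]
      refine (wr_ds k).trans ?_
      rw [hbot, MonoidHom.comap_bot, (MonoidHom.ker_eq_bot_iff _).mpr SemidirectProduct.inl_injective,
        Subgroup.map_bot]
  · rw [SemidirectProduct.card, agl_card, Nat.card_fun,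
      ArithmeticFunction.cardFactors_mul (pow_ne_zero _ Nat.card_pos.ne') (by norm_num),
      ArithmeticFunction.cardFactors_pow, cf_432]
    have : Nat.card Vt = 9 := by simp
    rw [this]
    omega

open ArithmeticFunction in
theorem cf_ps (m k : ℕ) : cardFactors (2 ^ m * 3 ^ k) = m + k := by
  rw [cardFactors_mul (by positivity) (by positivity),
    cardFactors_apply_prime_pow Nat.prime_two, cardFactors_apply_prime_pow Nat.prime_three]

theorem ds_ne_bot {G : Type*} [Group G] {n : ℕ} {x : G} (hx : x ∈ derivedSeries G n) (h1 : x ≠ 1) :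
    ∀ k < n + 1, derivedSeries G k ≠ ⊥ := by
  intro k hk hb
  have := derivedSeries_antitone G (by omega : k ≤ n) hx
  rw [hb, Subgroup.mem_bot] at this
  exact h1 this

theorem dl0 : HasDL 0 0 :=
  ⟨Unit, inferInstance, inferInstance, inferInstance, fun k hk => absurd hk (by omega), by simp⟩

theorem dl1 : HasDL 1 1 := by
  refine ⟨Multiplicative (ZMod 2), inferInstance, inferInstance, inferInstance,
    ds_ne_bot (n := 0) (x := Multiplicative.ofAdd 1) trivial (by decide), ?_⟩
  rw [show Nat.card (Multiplicative (ZMod 2)) = 2 ^ 1 * 3 ^ 0 by simp, cf_ps]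

theorem s3_solv : Group.IsSolvable (Equiv.Perm (Fin 3)) := by
  refine ⟨2, ?_⟩
  have h1 : derivedSeries (Equiv.Perm (Fin 3)) 1 ≤ (Equiv.Perm.sign (α := Fin 3)).ker := by
    rw [derivedSeries_one]
    exact Abelianization.commutator_subset_ker _
  rw [derivedSeries_succ, Subgroup.commutator_eq_bot_iff_le_centralizer]
  intro x hx y hy
  have hx' := h1 hx
  have hy' := h1 hy
  rw [MonoidHom.mem_ker] at hx' hy'
  clear hx hy h1
  revert x y
  decide

theorem dl2 : HasDL 2 2 := by
  refine ⟨Equiv.Perm (Fin 3), inferInstance, inferInstance, s3_solv, ?_, ?_⟩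
  · refine ds_ne_bot (n := 1) (x := Equiv.swap 0 1 * Equiv.swap 1 2 * (Equiv.swap 0 1)⁻¹ *
      (Equiv.swap 1 2)⁻¹) (ds_comm trivial trivial rfl) (by decide)
  · rw [show Nat.card (Equiv.Perm (Fin 3)) = 2 ^ 1 * 3 ^ 1 by
      rw [Nat.card_perm, Nat.card_fin]; rfl, cf_ps]

theorem dl4 : HasDL 4 5 := by
  refine ⟨GLt, inferInstance, inferInstance, gl_solv, ds_ne_bot gl_z_mem gl_z_ne, ?_⟩
  rw [gl_card, show 48 = 2 ^ 4 * 3 ^ 1 by norm_num, cf_ps]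

theorem dl3 : HasDL 3 4 := by
  have := gl_solv
  refine ⟨derivedSeries GLt 1, inferInstance, inferInstance, inferInstance, ?_, ?_⟩
  · obtain ⟨h1, h2⟩ := ds_add_mem (derivedSeries GLt 1) 1 2 le_rfl gl_z_mem
    refine ds_ne_bot h2 ?_
    intro h
    exact gl_z_ne (congrArg Subtype.val h)
  · rcases ub_omega (G := GLt) 1 with h | h
    · exact absurd h (ds_ne_bot gl_z_mem gl_z_ne 1 (by omega))
    · rw [gl_card, show 48 = 2 ^ 4 * 3 ^ 1 by norm_num, cf_ps] at h
      omega

theorem dl_iter {r w : ℕ} (h : HasDL r w) (k : ℕ) :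
    ∃ w', HasDL (5 * k + r) w' ∧ 8 * w' + 7 = 9 ^ k * (8 * w + 7) := by
  induction k with
  | zero => exact ⟨w, by simpa using h, by simp⟩
  | succ k ih =>
    obtain ⟨w', h1, h2⟩ := ih
    refine ⟨9 * w' + 7, ?_, by rw [pow_succ]; linarith⟩
    have := h1.step
    rwa [show 5 * (k + 1) + r = 5 * k + r + 5 by ring]

theorem dl_bound {r w : ℕ} (h : HasDL r w) (hw : (8 * w + 7) ^ 15 < 8 ^ 15 * 9 ^ (3 * r + 2)) (k : ℕ) :
    ∃ w', HasDL (5 * k + r) w' ∧ w' ^ 15 < 9 ^ (3 * (5 * k + r) + 2) := by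
  obtain ⟨w', h1, h2⟩ := dl_iter h k
  refine ⟨w', h1, ?_⟩
  have h3 : (8 * w') ^ 15 ≤ (8 * w' + 7) ^ 15 := Nat.pow_le_pow_left (by omega) _
  rw [h2, mul_pow, mul_pow, ← pow_mul] at h3
  have h4 : 9 ^ (k * 15) * (8 * w + 7) ^ 15 < 9 ^ (k * 15) * (8 ^ 15 * 9 ^ (3 * r + 2)) :=
    Nat.mul_lt_mul_of_pos_left hw (by positivity)
  have h5 : 9 ^ (k * 15) * (8 ^ 15 * 9 ^ (3 * r + 2)) = 8 ^ 15 * 9 ^ (3 * (5 * k + r) + 2) := by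
    rw [show 3 * (5 * k + r) + 2 = k * 15 + (3 * r + 2) by ring, pow_add]; ring
  rw [h5] at h4
  exact Nat.lt_of_mul_lt_mul_left (lt_of_le_of_lt h3 h4)

theorem dl_all (d : ℕ) : ∃ w, HasDL d w ∧ w ^ 15 < 9 ^ (3 * d + 2) := by
  have h := Nat.div_add_mod d 5
  have hlt : d % 5 < 5 := Nat.mod_lt _ (by norm_num)
  set k := d / 5
  set r := d % 5
  clear_value k r
  subst h
  interval_cases r
  · exact dl_bound dl0 (by norm_num) k
  · exact dl_bound dl1 (by norm_num) k
  · exact dl_bound dl2 (by norm_num) k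
  · exact dl_bound dl3 (by norm_num) k
  · exact dl_bound dl4 (by norm_num) k

theorem dl_exact {d w : ℕ} (h : HasDL d w) : ∃ (G : Type) (_ : Group G) (_ : Finite G),
    Group.IsSolvable G ∧ DerivedLengthEq G d ∧ Omega (Nat.card G) ≤ w := by
  obtain ⟨G, _, _, h1, h2, h3⟩ := h
  have hs : Function.Surjective (QuotientGroup.mk' (derivedSeries G d)) :=
    QuotientGroup.mk'_surjective _
  refine ⟨G ⧸ derivedSeries G d, inferInstance, inferInstance, inferInstance, ⟨?_, ?_⟩, ?_⟩
  · rw [← map_derivedSeries_eq hs, Subgroup.map_eq_bot_iff, QuotientGroup.ker_mk']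
  · intro k hk hb
    rw [← map_derivedSeries_eq hs, Subgroup.map_eq_bot_iff, QuotientGroup.ker_mk'] at hb
    have hlt : derivedSeries G (k + 1) < derivedSeries G k :=
      Group.IsSolvable.commutator_lt_of_ne_bot (h2 k hk)
    exact absurd (hb.trans (derivedSeries_antitone G (by omega : k + 1 ≤ d))) (not_le_of_gt hlt)
  · have := card_factors_quot (derivedSeries G d)
    change ArithmeticFunction.cardFactors (derivedSeries G d).index ≤ w
    omega

theorem lb_final (d c : ℕ) (hc : 1 ≤ c) (h : c ^ 15 < 9 ^ (3 * d + 2)) :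
    (5 * Real.logb 9 2) * Real.logb 2 c - 2 / 3 < d := by
  have hcR : (0 : ℝ) < c := by exact_mod_cast hc
  have h' : (c : ℝ) ^ 15 < 9 ^ (3 * d + 2) := by exact_mod_cast h
  have h4 := Real.logb_lt_logb (b := 9) (by norm_num) (by positivity) h'
  rw [Real.logb_pow, Real.logb_pow, Real.logb_self_eq_one (by norm_num)] at h4
  rw [mul_assoc, Real.mul_logb (by norm_num) (by norm_num) (by norm_num)]
  push_cast at h4
  linarith

/-- If `c` is the minimal composition length of a finite solvable group with derived
length `d ≥ 1`, then `γ·log₂ c − 2/3 < d < (γ+1)·log₂ c + 3`, where `γ = 5·log₉ 2`. -/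
theorem solvable_min_comp_length_bounds (d c : ℕ) (hd : 1 ≤ d)
    (hc : IsLeast {m : ℕ | ∃ (G : Type) (_ : Group G) (_ : Finite G),
      IsSolvable G ∧ DerivedLengthEq G d ∧ Omega (Nat.card G) = m} c) :
    (5 * Real.logb 9 2) * Real.logb 2 c - 2 / 3 < d ∧
      (d : ℝ) < (5 * Real.logb 9 2 + 1) * Real.logb 2 c + 3 := by
  obtain ⟨⟨G, _, _, h1, h2, h3⟩, hmin⟩ := hc
  have hsolv : Group.IsSolvable G := h1
  have hdc : d ≤ c := by rw [← h3]; exact ub_dl d h2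
  constructor
  · obtain ⟨w, hw, hlt⟩ := dl_all d
    obtain ⟨H, i1, i2, g1, g2, g3⟩ := dl_exact hw
    have hcw : c ≤ w := (hmin ⟨H, i1, i2, g1, g2, rfl⟩).trans g3
    exact lb_final d c (by omega) (lt_of_le_of_lt (Nat.pow_le_pow_left hcw 15) hlt)
  · obtain ⟨s, n, hn, hs, hns, hd'⟩ := ub_chief d hd h2
    rw [h3] at hns
    exact ub_final d c s n hd hdc hn hs hns hd'
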